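/- arXiv:1212.3064 — 2 statements merged into one kernel-verified Lean document; each statement's English description precedes it below -/
import Mathlib

section
/- Suppose φ is Sturmian. Then φ is eventually periodic if and only if there exists a nonempty finite connected subgraph K of T whose coloring appears exactly once: the only connected subgraph K' of T admitting a graph isomorphism from K to K' that preserves φ is K itself. -/
open SimpleGraph

/-- Equivalence of colored `n`-balls around `x` and `y`: a graph isomorphism between the
induced subgraphs on the balls, sending center to center and preserving the coloring. -/
def BallEquiv {V A : Type*} (T : SimpleGraph V) (φ : V → A) (n : ℕ) (x y : V) : Prop :=
  ∃ f : {v : V // T.dist x v ≤ n} ≃ {v : V // T.dist y v ≤ n},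
    ((f ⟨x, by simp [SimpleGraph.dist_self]⟩ : {v : V // T.dist y v ≤ n}) : V) = y ∧
    (∀ u w : {v : V // T.dist x v ≤ n}, T.Adj (u : V) (w : V) ↔ T.Adj (f u : V) (f w : V)) ∧
    ∀ v : {v : V // T.dist x v ≤ n}, φ (f v : V) = φ (v : V)

/-- Two vertices are in the same class if a color-preserving automorphism of `T`
sends one to the other. -/
def SameClass {V A : Type*} (T : SimpleGraph V) (φ : V → A) (x y : V) : Prop :=
  ∃ g : V ≃ V, (∀ u w : V, T.Adj (g u) (g w) ↔ T.Adj u w) ∧ g x = y ∧ ∀ v, φ (g v) = φ v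

/-- Subword complexity: the number of equivalence classes of colored `n`-balls. -/
noncomputable def ballComplexity {V A : Type*} (T : SimpleGraph V) (φ : V → A) (n : ℕ) : ℕ :=
  Nat.card (Quot (BallEquiv T φ n))

/-- A coloring is periodic if it is invariant under a subgroup of the automorphism group
of `T` having finitely many orbits on vertices. -/
def IsPeriodicColoring {V A : Type*} (T : SimpleGraph V) (φ : V → A) : Prop :=
  ∃ Γ : Subgroup (Equiv.Perm V),
    (∀ γ ∈ Γ, ∀ u w : V, T.Adj (γ u) (γ w) ↔ T.Adj u w) ∧
    (∀ γ ∈ Γ, ∀ v, φ (γ v) = φ v) ∧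
    Finite (Quot (fun x y : V => ∃ γ ∈ Γ, γ x = y))

/-- The colored `n`-ball around `x` is special. -/
def IsSpecial {V A : Type*} (T : SimpleGraph V) (φ : V → A) (n : ℕ) (x : V) : Prop :=
  ∃ y z : V, BallEquiv T φ n x y ∧ BallEquiv T φ n x z ∧ ¬ BallEquiv T φ (n + 1) y z

/-- The type set of a vertex. -/
def TypeSet {V A : Type*} (T : SimpleGraph V) (φ : V → A) (x : V) : Set ℕ :=
  {n : ℕ | IsSpecial T φ n x}

/-- The maximal type of a vertex of bounded type (`-1` if the type set is empty). -/
noncomputable def maxType {V A : Type*} (T : SimpleGraph V) (φ : V → A) (x : V) : ℤ :=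
  sSup (insert (-1) ((fun n : ℕ => (n : ℤ)) '' TypeSet T φ x))

/-- The coloring is Sturmian if its subword complexity is `n + 2`. -/
def IsSturmian {V A : Type*} (T : SimpleGraph V) (φ : V → A) : Prop :=
  ∀ n : ℕ, ballComplexity T φ n = n + 2

/-- Eventually periodic coloring. -/
def IsEventuallyPeriodic {V A : Type*} (T : SimpleGraph V) (φ : V → A) : Prop :=
  ∃ K : Set V, K.Nonempty ∧ K.Finite ∧ (T.induce K).Connected ∧
    ∀ v : (Kᶜ : Set V), ∃ ψ : V → A, IsPeriodicColoring T ψ ∧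
      ∀ w : (Kᶜ : Set V), (T.induce (Kᶜ : Set V)).Reachable v w → ψ (w : V) = φ (w : V)

/-- The vertex set of the `n`-branch from `x` towards its neighbor `x'`. -/
def branchSet {V : Type*} (T : SimpleGraph V) (n : ℕ) (x x' : V) : Set V :=
  insert x {y : V | T.dist x y ≤ n ∧ T.dist y x' < T.dist y x}

/-- Equivalence of colored `n`-branches. -/
def BranchEquiv {V A : Type*} (T : SimpleGraph V) (φ : V → A) (n : ℕ)
    (x x' y y' : V) : Prop :=
  ∃ f : (branchSet T n x x') ≃ (branchSet T n y y'),
    ((f ⟨x, Set.mem_insert x _⟩ : (branchSet T n y y')) : V) = y ∧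
    (∀ u w : (branchSet T n x x'), T.Adj (u : V) (w : V) ↔ T.Adj (f u : V) (f w : V)) ∧
    ∀ v : (branchSet T n x x'), φ (f v : V) = φ (v : V)

/-- A coloring of `K` appears exactly once if the only connected subgraph of `T`
color-isomorphic to it is `K` itself. -/
def AppearsOnce {V A : Type*} (T : SimpleGraph V) (φ : V → A) (K : Set V) : Prop :=
  ∀ K' : Set V, (T.induce K').Connected →
    (∃ f : K ≃ K', (∀ u w : K, T.Adj (u : V) (w : V) ↔ T.Adj (f u : V) (f w : V)) ∧
      ∀ v : K, φ (f v : V) = φ (v : V)) → K' = K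

namespace SturmianTree

section Tree

variable {V A : Type*} {T : SimpleGraph V}

lemma parent_unique (hT : T.IsTree) {v u p q : V} (hp : T.Adj p u) (hq : T.Adj q u)
    (hdp : T.dist v u = T.dist v p + 1) (hdq : T.dist v u = T.dist v q + 1) : p = q := by
  obtain ⟨P, -, hPl⟩ := hT.connected.exists_path_of_dist v p
  obtain ⟨Q, -, hQl⟩ := hT.connected.exists_path_of_dist v q
  have h1 : (P.concat hp).IsPath :=
    Walk.isPath_of_length_eq_dist _ (by rw [Walk.length_concat, hPl, hdp])
  have h2 : (Q.concat hq).IsPath :=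
    Walk.isPath_of_length_eq_dist _ (by rw [Walk.length_concat, hQl, hdq])
  have h3 := (hT.existsUnique_path v u).unique h1 h2
  rw [← Walk.penultimate_concat P hp, h3, Walk.penultimate_concat]

lemma exists_parent (hc : T.Connected) {v u : V} (h : u ≠ v) :
    ∃ p, T.Adj p u ∧ T.dist v u = T.dist v p + 1 := by
  obtain ⟨P, hP, hPl⟩ := hc.exists_path_of_dist v u
  have hn : ¬ P.Nil := fun hn => h hn.eq.symm
  refine ⟨P.penultimate, P.adj_penultimate hn, ?_⟩
  have h1 : T.dist v P.penultimate ≤ P.dropLast.length := dist_le _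
  have h2 := P.length_dropLast_add_one hn
  have h3 : T.dist P.penultimate u = 1 := dist_eq_one_iff_adj.2 (P.adj_penultimate hn)
  have h4 := hc.dist_triangle (u := v) (v := P.penultimate) (w := u)
  omega

lemma parent_mem (hT : T.IsTree) {S : Set V} {a b p : V} {ha : a ∈ S} {hb : b ∈ S}
    (hr : (T.induce S).Reachable ⟨a, ha⟩ ⟨b, hb⟩) (hp : T.Adj p b)
    (hd : T.dist a b = T.dist a p + 1) :
    ∃ h : p ∈ S, (T.induce S).Reachable ⟨a, ha⟩ ⟨p, h⟩ := by
  obtain ⟨W, hW⟩ := hr.exists_isPath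
  have hn : ¬ W.Nil := fun hn => by
    have : a = b := congrArg Subtype.val hn.eq
    subst this
    simp at hd
  have hmap : (W.map (Embedding.induce S).toHom).IsPath :=
    hW.map Subtype.val_injective
  obtain ⟨P, hP, hPl⟩ := hT.connected.exists_path_of_dist a b
  have hlen : W.length = T.dist a b := by
    rw [← hPl, ← (hT.existsUnique_path a b).unique hmap hP]
    exact (W.length_map _).symm
  have hadj : T.Adj (W.penultimate : V) b := W.adj_penultimate hn
  have h1 : T.dist a W.penultimate ≤ W.dropLast.length := by
    have := dist_le (W.dropLast.map (Embedding.induce S).toHom)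
    rwa [Walk.length_map] at this
  have h2 := W.length_dropLast_add_one hn
  have h3 : T.dist (W.penultimate : V) b = 1 := dist_eq_one_iff_adj.2 hadj
  have h4 := hT.connected.dist_triangle (u := a) (v := W.penultimate) (w := b)
  have h5 : p = W.penultimate := parent_unique hT hp hadj hd (by omega)
  subst h5
  exact ⟨W.penultimate.2, W.dropLast.reachable⟩

lemma inter_connected (hT : T.IsTree) {S S' : Set V} (hS : (T.induce S).Connected)
    (hS' : (T.induce S').Connected) (hne : (S ∩ S').Nonempty) :
    (T.induce (S ∩ S')).Connected := by
  obtain ⟨a, ha⟩ := hne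
  have key : ∀ n b, T.dist a b = n → ∀ hb : b ∈ S ∩ S',
      (T.induce (S ∩ S')).Reachable ⟨a, ha⟩ ⟨b, hb⟩ := by
    intro n
    induction n with
    | zero =>
      intro b hd hb
      have : a = b := hT.connected.dist_eq_zero_iff.1 hd
      subst this
      exact Reachable.refl _
    | succ n ih =>
      intro b hd hb
      have hne : b ≠ a := by rintro rfl; simp at hd
      obtain ⟨p, hp, hdp⟩ := exists_parent hT.connected hne
      obtain ⟨h1, -⟩ := parent_mem hT (hS.preconnected ⟨a, ha.1⟩ ⟨b, hb.1⟩) hp hdp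
      obtain ⟨h2, -⟩ := parent_mem hT (hS'.preconnected ⟨a, ha.2⟩ ⟨b, hb.2⟩) hp hdp
      refine (ih p (by omega) ⟨h1, h2⟩).trans (Adj.reachable ?_)
      exact hp
  have : Nonempty ↥(S ∩ S') := ⟨⟨a, ha⟩⟩
  exact ⟨fun x y => (key _ x.1 rfl x.2).symm.trans (key _ y.1 rfl y.2)⟩

lemma ball_reachable (hc : T.Connected) {S : Set V} {y : V} {n : ℕ}
    (hS : {v | T.dist y v ≤ n} ⊆ S) (hy : y ∈ S) {u : V} (hu : T.dist y u ≤ n) :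
    (T.induce S).Reachable ⟨y, hy⟩ ⟨u, hS hu⟩ := by
  have key : ∀ m u, T.dist y u = m → ∀ h : u ∈ S, m ≤ n →
      (T.induce S).Reachable ⟨y, hy⟩ ⟨u, h⟩ := by
    intro m
    induction m with
    | zero =>
      intro u hd h _
      have : y = u := hc.dist_eq_zero_iff.1 hd
      subst this
      exact Reachable.refl _
    | succ m ih =>
      intro u hd h hm
      have hne : u ≠ y := by rintro rfl; simp at hd
      obtain ⟨p, hp, hdp⟩ := exists_parent hc hne
      have hpS : p ∈ S := hS (show T.dist y p ≤ n by omega)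
      refine (ih p (by omega) hpS (by omega)).trans (Adj.reachable ?_)
      exact hp
  exact key _ u rfl _ hu

lemma exists_boundary_reachable (hc : T.Connected) {K : Set V} (hK : K.Nonempty) {y : V}
    (hy : y ∈ Kᶜ) : ∃ v, ∃ hv : v ∈ Kᶜ, (∃ a ∈ K, T.Adj a v) ∧
      (T.induce Kᶜ).Reachable ⟨v, hv⟩ ⟨y, hy⟩ := by
  obtain ⟨a, ha⟩ := hK
  have key : ∀ m y, T.dist a y = m → ∀ hy : y ∈ Kᶜ, ∃ v, ∃ hv : v ∈ Kᶜ,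
      (∃ a ∈ K, T.Adj a v) ∧ (T.induce Kᶜ).Reachable ⟨v, hv⟩ ⟨y, hy⟩ := by
    intro m
    induction m with
    | zero =>
      intro y hd hy
      have : a = y := hc.dist_eq_zero_iff.1 hd
      subst this
      exact absurd ha hy
    | succ m ih =>
      intro y hd hy
      have hne : y ≠ a := by rintro rfl; simp at hd
      obtain ⟨p, hp, hdp⟩ := exists_parent hc hne
      by_cases hpK : p ∈ K
      · exact ⟨y, hy, ⟨p, hpK, hp⟩, Reachable.refl _⟩
      · obtain ⟨v, hv, hb, hr⟩ := ih p (by omega) hpK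
        refine ⟨v, hv, hb, hr.trans (Adj.reachable ?_)⟩
        exact hp
  exact key _ y rfl hy

lemma finite_neighborSet {k : ℕ} (hk : 0 < k) (hreg : ∀ v : V, (T.neighborSet v).ncard = k)
    (v : V) : (T.neighborSet v).Finite :=
  Set.finite_of_ncard_pos (by rw [hreg]; exact hk)

lemma finite_ball (hc : T.Connected) (hf : ∀ v, (T.neighborSet v).Finite) (v : V) (n : ℕ) :
    {u | T.dist v u ≤ n}.Finite := by
  induction n with
  | zero =>
    refine (Set.finite_singleton v).subset fun u hu => ?_
    have : T.dist v u = 0 := by simpa using hu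
    exact (hc.dist_eq_zero_iff.1 this).symm
  | succ n ih =>
    refine ((ih.biUnion fun u _ => hf u).union ih).subset fun u hu => ?_
    by_cases h : T.dist v u ≤ n
    · exact Or.inr h
    · have hne : u ≠ v := by rintro rfl; simp at h
      obtain ⟨p, hp, hdp⟩ := exists_parent hc hne
      have hu' : T.dist v u ≤ n + 1 := hu
      exact Or.inl (Set.mem_biUnion (show T.dist v p ≤ n by omega) hp)

lemma dist_adj_le (hc : T.Connected) (v : V) {u w : V} (h : T.Adj u w) :
    T.dist v w ≤ T.dist v u + 1 := by
  have := hc.dist_triangle (u := v) (v := u) (w := w)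
  rwa [dist_eq_one_iff_adj.2 h] at this

/-- A map that is an injective graph homomorphism on a set containing a ball of a regular graph
maps that ball onto a ball. -/
lemma image_ball {k : ℕ} (hc : T.Connected) (hk : 0 < k)
    (hreg : ∀ v : V, (T.neighborSet v).ncard = k) {S : Set V} {f : V → V} (hinj : S.InjOn f)
    (hadj : ∀ u ∈ S, ∀ w ∈ S, T.Adj u w → T.Adj (f u) (f w)) {y : V} {n : ℕ}
    (hS : {v | T.dist y v ≤ n} ⊆ S) :
    f '' {v | T.dist y v ≤ n} = {v | T.dist (f y) v ≤ n} := by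
  induction n with
  | zero =>
    ext u
    simp only [Nat.le_zero, hc.dist_eq_zero_iff, Set.mem_image, Set.mem_ofPred_eq]
    simp
  | succ n ih =>
    have hsub : {v | T.dist y v ≤ n} ⊆ {v | T.dist y v ≤ n + 1} :=
      fun v hv => le_trans hv (Nat.le_succ n)
    have ih := ih (hsub.trans hS)
    ext u
    constructor
    · rintro ⟨w, hw, rfl⟩
      by_cases h : T.dist y w ≤ n
      · exact le_trans (ih.subset ⟨w, h, rfl⟩) (Nat.le_succ n)
      · have hne : w ≠ y := by rintro rfl; simp at h
        obtain ⟨p, hp, hdp⟩ := exists_parent hc hne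
        have hw' : T.dist y w ≤ n + 1 := hw
        have hpn : T.dist y p ≤ n := by omega
        have h1 : T.dist (f y) (f p) ≤ n := ih.subset ⟨p, hpn, rfl⟩
        have h2 := dist_adj_le hc (f y) (hadj p (hS (hsub hpn)) w (hS hw) hp)
        exact h2.trans (by omega)
    · intro hu
      by_cases h : T.dist (f y) u ≤ n
      · obtain ⟨w, hw, rfl⟩ := ih.superset h
        exact ⟨w, hsub hw, rfl⟩
      · have hne : u ≠ f y := by rintro rfl; simp at h
        obtain ⟨p, hp, hdp⟩ := exists_parent hc hne
        have hu' : T.dist (f y) u ≤ n + 1 := hu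
        obtain ⟨q, hq, rfl⟩ := ih.superset (show T.dist (f y) p ≤ n by omega)
        have hq' : T.dist y q ≤ n := hq
        have hN : T.neighborSet q ⊆ {v | T.dist y v ≤ n + 1} := fun w hw =>
          (dist_adj_le hc y hw).trans (by omega)
        have himg : f '' T.neighborSet q = T.neighborSet (f q) := by
          apply Set.eq_of_subset_of_ncard_le
          · rintro _ ⟨w, hw, rfl⟩
            exact hadj q (hS (hsub hq)) w (hS (hN hw)) hw
          · rw [hreg, (hinj.mono (hN.trans hS)).ncard_image, hreg]
          · exact finite_neighborSet hk hreg _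
        obtain ⟨w, hw, rfl⟩ := himg.superset hp
        exact ⟨w, hN hw, rfl⟩

end Tree

section Ball

variable {V A : Type*} {T : SimpleGraph V} {φ : V → A}

lemma ballEquiv_refl (n : ℕ) (x : V) : BallEquiv T φ n x x :=
  ⟨Equiv.refl _, rfl, fun _ _ => Iff.rfl, fun _ => rfl⟩

lemma _root_.BallEquiv.symm {n : ℕ} {x y : V} (h : BallEquiv T φ n x y) : BallEquiv T φ n y x := by
  obtain ⟨f, hx, hadj, hφ⟩ := h
  refine ⟨f.symm, ?_, fun u w => ?_, fun v => ?_⟩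
  · have h : f ⟨x, by simp⟩ = ⟨y, by simp⟩ := Subtype.ext hx
    exact congrArg Subtype.val (f.symm_apply_eq.2 h.symm)
  · rw [hadj, f.apply_symm_apply, f.apply_symm_apply]
  · rw [← hφ, f.apply_symm_apply]

lemma _root_.BallEquiv.trans {n : ℕ} {x y z : V} (h : BallEquiv T φ n x y)
    (h' : BallEquiv T φ n y z) :
    BallEquiv T φ n x z := by
  obtain ⟨f, hx, hadj, hφ⟩ := h
  obtain ⟨g, hx', hadj', hφ'⟩ := h'
  refine ⟨f.trans g, ?_, fun u w => ?_, fun v => ?_⟩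
  · rw [Equiv.trans_apply, Subtype.ext hx (a2 := ⟨y, by simp⟩)]
    exact hx'
  · rw [hadj, hadj']; rfl
  · rw [Equiv.trans_apply, hφ', hφ]

lemma ballEquiv_equivalence (n : ℕ) : Equivalence (BallEquiv T φ n) :=
  ⟨ballEquiv_refl n, BallEquiv.symm, BallEquiv.trans⟩

lemma _root_.BallEquiv.exists_map {n : ℕ} {x y : V} (h : BallEquiv T φ n x y) :
    ∃ f : V → V, f x = y ∧ Set.InjOn f {v | T.dist x v ≤ n} ∧
      (∀ u ∈ {v | T.dist x v ≤ n}, ∀ w ∈ {v | T.dist x v ≤ n}, T.Adj u w ↔ T.Adj (f u) (f w)) ∧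
      ∀ v ∈ {v | T.dist x v ≤ n}, φ (f v) = φ v := by
  classical
  obtain ⟨f, hx, hadj, hφ⟩ := h
  have hf : ∀ v (hv : T.dist x v ≤ n),
      (fun v => if hv : T.dist x v ≤ n then (f ⟨v, hv⟩ : V) else v) v = f ⟨v, hv⟩ :=
    fun v hv => dif_pos hv
  refine ⟨fun v => if hv : T.dist x v ≤ n then (f ⟨v, hv⟩ : V) else v, ?_, ?_, ?_, ?_⟩
  · rw [hf x (by simp)]; exact hx
  · intro u hu w hw h
    rw [hf u hu, hf w hw] at h
    exact congrArg Subtype.val (f.injective (Subtype.ext h))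
  · intro u hu w hw
    rw [hf u hu, hf w hw]
    exact hadj ⟨u, hu⟩ ⟨w, hw⟩
  · intro v hv
    rw [hf v hv]
    exact hφ ⟨v, hv⟩

lemma ballEquiv_of_map {k : ℕ} (hc : T.Connected) (hk : 0 < k)
    (hreg : ∀ v : V, (T.neighborSet v).ncard = k) {S : Set V} {f : V → V} (hinj : S.InjOn f)
    (hadj : ∀ u ∈ S, ∀ w ∈ S, T.Adj u w ↔ T.Adj (f u) (f w)) (hφ : ∀ v ∈ S, φ (f v) = φ v)
    {y : V} {n : ℕ} (hS : {v | T.dist y v ≤ n} ⊆ S) : BallEquiv T φ n y (f y) := by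
  have himg := image_ball hc hk hreg hinj (fun u hu w hw => (hadj u hu w hw).1) hS
  have hb : Set.BijOn f {v | T.dist y v ≤ n} {v | T.dist (f y) v ≤ n} := by
    rw [← himg]
    exact (hinj.mono hS).bijOn_image
  exact ⟨hb.equiv f, rfl, fun u w => hadj u (hS u.2) w (hS w.2), fun v => hφ v (hS v.2)⟩

end Ball

section FiniteClass

variable {V A : Type*} {T : SimpleGraph V} {φ : V → A}

lemma exists_finite_class_of_appearsOnce {K : Set V} (hne : K.Nonempty) (hfin : K.Finite)
    (hconn : (T.induce K).Connected) (honce : AppearsOnce T φ K) :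
    ∃ n x, {y | BallEquiv T φ n x y}.Finite := by
  obtain ⟨x, hx⟩ := hne
  obtain ⟨n, hn⟩ := (hfin.image (T.dist x)).bddAbove
  refine ⟨n, x, hfin.subset fun y hy => ?_⟩
  obtain ⟨f, rfl, hinj, hadj, hφ⟩ := BallEquiv.exists_map hy
  have hK : K ⊆ {v | T.dist x v ≤ n} := fun v hv => hn ⟨v, hv, rfl⟩
  have hb : Set.BijOn f K (f '' K) := (hinj.mono hK).bijOn_image
  have hK' : f '' K = K := by
    apply honce
    · let e : T.induce K ≃g T.induce (f '' K) :=
        ⟨hb.equiv f, fun {u w} => (hadj u (hK u.2) w (hK w.2)).symm⟩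
      exact e.connected_iff.1 hconn
    · exact ⟨hb.equiv f, fun u w => hadj u (hK u.2) w (hK w.2), fun v => hφ v (hK v.2)⟩
  exact hK'.subset ⟨x, hx, rfl⟩

lemma exists_appearsOnce_of_finite_class {k : ℕ} (hT : T.IsTree) (hk : 0 < k)
    (hreg : ∀ v : V, (T.neighborSet v).ncard = k) {n : ℕ} {x : V}
    (hC : {y | BallEquiv T φ n x y}.Finite) :
    ∃ K : Set V, K.Nonempty ∧ K.Finite ∧ (T.induce K).Connected ∧ AppearsOnce T φ K := by
  classical
  have hc := hT.connected
  set C : Set V := {y | BallEquiv T φ n x y} with hCdef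
  set D : Set V := ⋃ y ∈ C, {v | T.dist y v ≤ n} with hDdef
  have hDfin : D.Finite :=
    hC.biUnion fun y _ => finite_ball hc (finite_neighborSet hk hreg) y n
  have hxD : x ∈ D := Set.mem_biUnion (ballEquiv_refl n x : x ∈ C) (by simp)
  obtain ⟨t, hDt, htc⟩ := extend_finset_to_connected hc.preconnected (t := hDfin.toFinset)
    ⟨x, by simpa using hxD⟩
  obtain ⟨K, ⟨hDK, hKfin, hKc⟩, hmin⟩ := (measure (Set.ncard (α := V))).wf.has_min
    {K : Set V | D ⊆ K ∧ K.Finite ∧ (T.induce K).Connected}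
    ⟨t, by simpa using hDt, t.finite_toSet, htc⟩
  refine ⟨K, ⟨x, hDK hxD⟩, hKfin, hKc, ?_⟩
  rintro K' hK'c ⟨f, hadj, hφ⟩
  let F : V → V := fun v => if h : v ∈ K then f ⟨v, h⟩ else v
  have hF : ∀ v (h : v ∈ K), F v = f ⟨v, h⟩ := fun v h => dif_pos h
  have hFinj : K.InjOn F := fun u hu w hw h => by
    rw [hF u hu, hF w hw] at h
    exact congrArg Subtype.val (f.injective (Subtype.ext h))
  have hFim : F '' K = K' := by
    ext v
    constructor
    · rintro ⟨u, hu, rfl⟩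
      rw [hF u hu]
      exact (f ⟨u, hu⟩).2
    · intro hv
      refine ⟨f.symm ⟨v, hv⟩, (f.symm ⟨v, hv⟩).2, ?_⟩
      rw [hF _ (f.symm ⟨v, hv⟩).2]
      simp
  have hFadj : ∀ u ∈ K, ∀ w ∈ K, T.Adj u w ↔ T.Adj (F u) (F w) := fun u hu w hw => by
    rw [hF u hu, hF w hw]
    exact hadj ⟨u, hu⟩ ⟨w, hw⟩
  have hFφ : ∀ v ∈ K, φ (F v) = φ v := fun v hv => by
    rw [hF v hv]
    exact hφ ⟨v, hv⟩
  have hball : ∀ y ∈ C, {v | T.dist y v ≤ n} ⊆ K := fun y hy =>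
    (Set.subset_biUnion_of_mem (u := fun y => {v | T.dist y v ≤ n}) hy).trans hDK
  have hCK : C ⊆ K := fun y hy => hball y hy (by simp)
  have hFC : F '' C = C := by
    apply Set.eq_of_subset_of_ncard_le _ _ hC
    · rintro _ ⟨y, hy, rfl⟩
      exact BallEquiv.trans hy (ballEquiv_of_map hc hk hreg hFinj hFadj hFφ (hball y hy))
    · rw [(hFinj.mono hCK).ncard_image]
  have hDK' : D ⊆ K' := by
    refine Set.iUnion₂_subset fun y hy => ?_
    obtain ⟨z, hz, rfl⟩ := hFC.superset hy
    rw [← image_ball hc hk hreg hFinj (fun u hu w hw => (hFadj u hu w hw).1) (hball z hz), ← hFim]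
    exact Set.image_mono (hball z hz)
  have hinter : K ∩ K' = K := by
    apply Set.eq_of_subset_of_ncard_le Set.inter_subset_left _ hKfin
    have := hmin (K ∩ K') ⟨Set.subset_inter hDK hDK', hKfin.subset Set.inter_subset_left,
      inter_connected hT hKc hK'c ⟨x, hDK hxD, hDK' hxD⟩⟩
    exact not_lt.1 this
  have hK'fin : K'.Finite := hFim ▸ hKfin.image F
  refine (Set.eq_of_subset_of_ncard_le (Set.inter_eq_left.1 hinter) ?_ hK'fin).symm
  rw [← hFim, hFinj.ncard_image]

lemma exists_finite_class_of_isEventuallyPeriodic {k : ℕ} (hT : T.IsTree) (hk : 0 < k)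
    (hreg : ∀ v : V, (T.neighborSet v).ncard = k) (hst : IsSturmian T φ)
    (hep : IsEventuallyPeriodic T φ) : ∃ n x, {y | BallEquiv T φ n x y}.Finite := by
  classical
  by_contra! hinf
  have hc := hT.connected
  have hlf := finite_neighborSet hk hreg
  obtain ⟨K, hKne, hKfin, -, hK⟩ := hep
  choose ψ hψ hψφ using hK
  choose Γ hΓadj hΓψ hΓfin using hψ
  let D : Set V := {v | v ∈ Kᶜ ∧ ∃ a ∈ K, T.Adj a v}
  have hDfin : D.Finite := by
    refine (hKfin.biUnion fun a _ => hlf a).subset ?_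
    rintro v ⟨-, a, ha, hav⟩
    exact Set.mem_biUnion ha hav
  have : Finite D := hDfin
  let X := Σ v : D, Quot (fun x y : V => ∃ γ ∈ Γ ⟨v, v.2.1⟩, γ x = y)
  have hX : Finite X := inferInstance
  have hbound : ∀ n, Nat.card (Quot (BallEquiv T φ n)) ≤ Nat.card X := by
    intro n
    have hfar : ∀ q : Quot (BallEquiv T φ n), ∃ y, Quot.mk _ y = q ∧
        {v | T.dist y v ≤ n} ⊆ Kᶜ := by
      intro q
      obtain ⟨x, rfl⟩ := Quot.exists_rep q
      obtain ⟨y, hy, hyK⟩ := (hinf n x).exists_notMem_finite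
        (hKfin.biUnion fun a _ => finite_ball hc hlf a n)
      refine ⟨y, (Quot.sound hy).symm, fun v hv hvK => hyK (Set.mem_biUnion hvK ?_)⟩
      have hv : T.dist y v ≤ n := hv
      rwa [dist_comm] at hv
    choose y hyq hyK using hfar
    have hyK' : ∀ q, y q ∈ Kᶜ := fun q => hyK q (by simp)
    have hb := fun q => exists_boundary_reachable hc hKne (hyK' q)
    choose v hv hvb hvr using hb
    let g : Quot (BallEquiv T φ n) → X := fun q =>
      ⟨⟨v q, hv q, hvb q⟩, Quot.mk _ (y q)⟩
    refine Nat.card_le_card_of_injective g fun q q' hqq => ?_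
    have hcol : ∀ q u, T.dist (y q) u ≤ n → ψ ⟨v q, hv q⟩ u = φ u := fun q u hu =>
      hψφ ⟨v q, hv q⟩ ⟨u, hyK q hu⟩ ((hvr q).trans (ball_reachable hc (hyK q) (hyK' q) hu))
    have hvv : v q = v q' := congrArg (fun a : X => (a.1 : V)) hqq
    have horb : ∃ γ ∈ Γ ⟨v q, hv q⟩, γ (y q) = y q' := by
      have key : ∀ (a b : D) (s t : V),
          (⟨a, Quot.mk _ s⟩ : X) = ⟨b, Quot.mk _ t⟩ → ∃ γ ∈ Γ ⟨a, a.2.1⟩, γ s = t := by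
        rintro a b s t hab
        obtain ⟨rfl, h⟩ := Sigma.mk.inj_iff.1 hab
        have heq : Equivalence (fun x y : V => ∃ γ ∈ Γ ⟨a, a.2.1⟩, γ x = y) :=
          ⟨fun x => ⟨1, one_mem _, rfl⟩,
            fun ⟨γ, hγ, h⟩ => ⟨γ⁻¹, inv_mem hγ, by rw [← h]; simp⟩,
            fun ⟨γ, hγ, h⟩ ⟨δ, hδ, h'⟩ => ⟨δ * γ, mul_mem hδ hγ, by simp [h, h']⟩⟩
        exact heq.quot_mk_eq_iff _ _ |>.1 (eq_of_heq h)
      exact key _ _ _ _ hqq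
    obtain ⟨γ, hγ, hγy⟩ := horb
    have hadj : ∀ u w, T.Adj u w ↔ T.Adj (γ u) (γ w) := fun u w => (hΓadj _ γ hγ u w).symm
    have hball := image_ball hc hk hreg (S := {u | T.dist (y q) u ≤ n}) (f := γ)
      γ.injective.injOn (fun u _ w _ h => (hadj u w).1 h) subset_rfl
    have hequiv : BallEquiv T φ n (y q) (γ (y q)) := by
      refine ballEquiv_of_map hc hk hreg (S := {u | T.dist (y q) u ≤ n}) γ.injective.injOn
        (fun u _ w _ => hadj u w) (fun u hu => ?_) subset_rfl
      have h1 : T.dist (γ (y q)) (γ u) ≤ n := hball.subset ⟨u, hu, rfl⟩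
      rw [hγy] at h1
      have h2 := hcol q' _ h1
      simp only [← hvv] at h2
      rw [← h2, hΓψ _ γ hγ, hcol q u hu]
    rw [hγy] at hequiv
    rw [← hyq q, ← hyq q']
    exact Quot.sound hequiv
  have h1 := hbound (Nat.card X)
  have h2 : Nat.card (Quot (BallEquiv T φ (Nat.card X))) = Nat.card X + 2 := hst _
  omega

end FiniteClass

section Labelling

variable {V L : Type*} {T : SimpleGraph V}

/-- The neighbors of `u`, labelled by `l`, and the neighbors of `u'`, labelled by `l'`, carry the
same labels with the same multiplicities. -/
def NeighborMatch (T : SimpleGraph V) (l l' : V → L) (u u' : V) : Prop :=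
  ∃ τ : V → V, Set.BijOn τ (T.neighborSet u) (T.neighborSet u') ∧
    ∀ w ∈ T.neighborSet u, l' (τ w) = l w

lemma NeighborMatch.symm {l l' : V → L} {u u' : V} (h : NeighborMatch T l l' u u') :
    NeighborMatch T l' l u' u := by
  obtain ⟨τ, hτ, hl⟩ := h
  have : Nonempty V := ⟨u⟩
  have hinv := hτ.invOn_invFunOn
  have hσ : Set.BijOn (Function.invFunOn τ (T.neighborSet u)) (T.neighborSet u')
    (T.neighborSet u) := (Set.bijOn_comm hinv).2 hτ
  refine ⟨_, hσ, fun w hw => ?_⟩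
  rw [← hl _ (hσ.mapsTo hw), hinv.2 hw]

lemma NeighborMatch.trans {l l' l'' : V → L} {u u' u'' : V} (h : NeighborMatch T l l' u u')
    (h' : NeighborMatch T l' l'' u' u'') : NeighborMatch T l l'' u u'' := by
  obtain ⟨τ, hτ, hl⟩ := h
  obtain ⟨σ, hσ, hl'⟩ := h'
  refine ⟨σ ∘ τ, hσ.comp hτ, fun w hw => ?_⟩
  rw [Function.comp_apply, hl' _ (hτ.mapsTo hw), hl w hw]

lemma exists_bijOn_swap {s t : Set V} {τ : V → V} (hτ : Set.BijOn τ s t) {q q' : V} (hq : q ∈ s)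
    (hq' : q' ∈ t) : ∃ σ : V → V, Set.BijOn σ s t ∧ σ q = q' ∧
      ∀ (l l' : V → L), (∀ w ∈ s, l' (τ w) = l w) → l' q' = l q → ∀ w ∈ s, l' (σ w) = l w := by
  classical
  have hswap : ∀ w ∈ t, Equiv.swap (τ q) q' w ∈ t := fun w hw => by
    by_cases h1 : w = τ q
    · rw [h1, Equiv.swap_apply_left]; exact hq'
    · by_cases h2 : w = q'
      · rw [h2, Equiv.swap_apply_right]; exact hτ.mapsTo hq
      · rwa [Equiv.swap_apply_of_ne_of_ne h1 h2]
  refine ⟨Equiv.swap (τ q) q' ∘ τ, ?_, by simp, fun l l' hl hlq w hw => ?_⟩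
  · exact Set.BijOn.comp ⟨hswap, (Equiv.injective _).injOn,
      fun w hw => ⟨_, hswap w hw, Equiv.swap_apply_self _ _ _⟩⟩ hτ
  · have h0 := hl q hq
    by_cases h1 : τ w = τ q
    · rw [Function.comp_apply, h1, Equiv.swap_apply_left, hτ.injOn hw hq h1, hlq]
    · by_cases h2 : τ w = q'
      · rw [Function.comp_apply, h2, Equiv.swap_apply_right, h0, ← hlq, ← h2, hl w hw]
      · rw [Function.comp_apply, Equiv.swap_apply_of_ne_of_ne h1 h2, hl w hw]

/-- Recursive definition of a function on a rooted tree: the value at a vertex is computed from the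
value at its parent. -/
lemma exists_parent_rec {X : Type*} (hT : T.IsTree) (v : V) (x₀ : X) (F : V → V → X → X) :
    ∃ g : V → X, g v = x₀ ∧
      ∀ p u, T.Adj p u → T.dist v u = T.dist v p + 1 → g u = F p u (g p) := by
  have hpar : ∀ u, ∃ p, u ≠ v → T.Adj p u ∧ T.dist v u = T.dist v p + 1 := fun u => by
    by_cases h : u = v
    · exact ⟨u, fun h' => absurd h h'⟩
    · obtain ⟨p, hp⟩ := exists_parent hT.connected h
      exact ⟨p, fun _ => hp⟩
  choose par hpar using hpar
  let G : ℕ → V → X := fun n => Nat.rec (fun _ => x₀) (fun _ g u => F (par u) u (g (par u))) n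
  refine ⟨fun u => G (T.dist v u) u, by simp [G], fun p u hpu hd => ?_⟩
  have hne : u ≠ v := by rintro rfl; simp at hd
  have hp : p = par u := parent_unique hT hpu (hpar u hne).1 hd (hpar u hne).2
  simp only [hd]
  subst hp
  rfl

/-- In a labelled tree in which the label of a vertex determines the labels of its neighbors,
vertices with the same label are related by a label-preserving automorphism. -/
lemma exists_automorphism (hT : T.IsTree) {l : V → L}
    (hl : ∀ u u', l u = l u' → NeighborMatch T l l u u') {x y : V} (hxy : l x = l y) :
    ∃ γ : Equiv.Perm V, (∀ u w, T.Adj (γ u) (γ w) ↔ T.Adj u w) ∧ (∀ v, l (γ v) = l v) ∧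
      γ x = y := by
  have hc := hT.connected
  have hτ : ∀ p p' q', ∃ τ : V → V, l p = l p' →
      (∀ q, T.Adj q p → T.dist x p = T.dist x q + 1 → T.Adj q' p' ∧ l q' = l q) →
      Set.BijOn τ (T.neighborSet p) (T.neighborSet p') ∧
      (∀ w ∈ T.neighborSet p, l (τ w) = l w) ∧
      ∀ q, T.Adj q p → T.dist x p = T.dist x q + 1 → τ q = q' := by
    intro p p' q'
    by_cases hp : l p = l p'
    swap
    · exact ⟨id, fun h => absurd h hp⟩
    obtain ⟨τ, hτ, hτl⟩ := hl p p' hp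
    by_cases hpx : p = x
    · subst hpx
      exact ⟨τ, fun _ _ => ⟨hτ, hτl, fun q _ hd => by simp at hd⟩⟩
    obtain ⟨q, hqp, hd⟩ := exists_parent hc hpx
    by_cases hq : T.Adj q' p' ∧ l q' = l q
    swap
    · exact ⟨id, fun _ h => absurd (h q hqp hd) hq⟩
    obtain ⟨σ, hσ, hσq, hσl⟩ := exists_bijOn_swap (L := L) hτ (q := q) (q' := q') hqp.symm
      hq.1.symm
    refine ⟨σ, fun _ _ => ⟨hσ, hσl l l hτl hq.2, fun q₁ hq₁ hd₁ => ?_⟩⟩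
    rw [parent_unique hT hq₁ hqp hd₁ hd, hσq]
  choose τ hτ using hτ
  obtain ⟨g, hgx, hg⟩ := exists_parent_rec hT x (y, y)
    fun p u (s : V × V) => (τ p s.1 s.2 u, s.1)
  let f : V → V := fun u => (g u).1
  have hinv : ∀ n u, T.dist x u = n → l u = l (f u) ∧
      ∀ q, T.Adj q u → T.dist x u = T.dist x q + 1 →
        (g u).2 = f q ∧ T.Adj (g u).2 (f u) ∧ l (g u).2 = l q := by
    intro n
    induction n with
    | zero =>
      intro u hd
      have : x = u := hc.dist_eq_zero_iff.1 hd
      subst this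
      refine ⟨by simp only [f, hgx, hxy], fun q _ hd => by simp at hd⟩
    | succ n ih =>
      intro u hd
      have hne : u ≠ x := by rintro rfl; simp at hd
      obtain ⟨p, hp, hdp⟩ := exists_parent hc hne
      obtain ⟨h1, h2⟩ := ih p (by omega)
      obtain ⟨hb, hbl, -⟩ := hτ p (f p) (g p).2 h1 fun q hq hdq => (h2 q hq hdq).2
      have hgu := hg p u hp hdp
      have hfu : f u = τ p (f p) (g p).2 u := congrArg Prod.fst hgu
      have hgu2 : (g u).2 = f p := congrArg Prod.snd hgu
      refine ⟨?_, fun q hq hdq => ?_⟩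
      · rw [hfu, hbl u hp]
      · obtain rfl := parent_unique hT hq hp hdq hdp
        rw [hgu2]
        refine ⟨rfl, ?_, h1.symm⟩
        rw [hfu]
        exact hb.mapsTo hp
  have hfl : ∀ u, l (f u) = l u := fun u => (hinv _ u rfl).1.symm
  have hfx : f x = y := by simp only [f, hgx]
  have hfb : ∀ p, Set.BijOn f (T.neighborSet p) (T.neighborSet (f p)) := by
    intro p
    obtain ⟨h1, h2⟩ := hinv _ p rfl
    obtain ⟨hb, -, hbq⟩ := hτ p (f p) (g p).2 h1 fun q hq hdq => (h2 q hq hdq).2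
    refine hb.congr fun w hw => ?_
    rcases hT.dist_eq_dist_add_one_of_adj x hw with h | h
    · rw [hbq w hw.symm h, (h2 w hw.symm h).1]
    · exact (congrArg Prod.fst (hg p w hw h)).symm
  have hfd : ∀ n u, T.dist x u = n → T.dist y (f u) = n := by
    intro n
    induction n using Nat.strong_induction_on with
    | _ n ih =>
      intro u hd
      by_cases hne : u = x
      · subst hne
        rw [hfx, dist_self, ← hd, dist_self]
      obtain ⟨p, hp, hdp⟩ := exists_parent hc hne
      have h1 := ih _ (by omega) p rfl
      rcases hT.dist_eq_dist_add_one_of_adj y ((hfb p).mapsTo hp) with h | h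
      · have hpx : p ≠ x := by rintro rfl; simp [hfx] at h
        obtain ⟨q, hq, hdq⟩ := exists_parent hc hpx
        have h2 := ih _ (by omega) q rfl
        have h3 : f q = f u := parent_unique hT (v := y) ((hfb p).mapsTo hq.symm).symm
          ((hfb p).mapsTo hp).symm (by omega) h
        have h4 := (hfb p).injOn hq.symm hp h3
        subst h4
        omega
      · omega
  have hinj : Function.Injective f := by
    have key : ∀ n u w, T.dist x u = n → f u = f w → u = w := by
      intro n
      induction n with
      | zero =>
        intro u w hd h
        have h1 := hfd _ u rfl
        have h2 := hfd _ w rfl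
        rw [h] at h1
        have h3 : x = u := hc.dist_eq_zero_iff.1 hd
        have h4 : x = w := hc.dist_eq_zero_iff.1 (by omega)
        rw [← h3, h4]
      | succ n ih =>
        intro u w hd h
        have h1 := hfd _ u rfl
        have h2 := hfd _ w rfl
        rw [h] at h1
        obtain ⟨p, hp, hdp⟩ := exists_parent (u := u) (v := x) hc (by rintro rfl; simp at hd)
        obtain ⟨q, hq, hdq⟩ := exists_parent (u := w) (v := x) hc
          (by rintro rfl; rw [dist_self] at h2; omega)
        have h3 := hfd _ p rfl
        have h4 := hfd _ q rfl
        have h5 : f p = f q := by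
          refine parent_unique hT (v := y) (u := f w) ?_ ((hfb q).mapsTo hq)
            (by omega) (by omega)
          rw [← h]
          exact (hfb p).mapsTo hp
        obtain rfl := ih p q (by omega) h5
        exact (hfb p).injOn hp hq h
    exact fun u w => key _ u w rfl
  have hsurj : Function.Surjective f := by
    have key : ∀ n w, T.dist y w = n → ∃ u, f u = w := by
      intro n
      induction n with
      | zero =>
        intro w hd
        exact ⟨x, hfx.trans (hc.dist_eq_zero_iff.1 hd)⟩
      | succ n ih =>
        intro w hd
        obtain ⟨p, hp, hdp⟩ := exists_parent (u := w) (v := y) hc (by rintro rfl; simp at hd)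
        obtain ⟨q, rfl⟩ := ih p (by omega)
        obtain ⟨u, -, rfl⟩ := (hfb q).surjOn hp
        exact ⟨u, rfl⟩
    exact fun w => key _ w rfl
  refine ⟨Equiv.ofBijective f ⟨hinj, hsurj⟩, fun u w => ⟨fun h => ?_, fun h => ?_⟩, hfl, hfx⟩
  · obtain ⟨w', hw', h'⟩ := (hfb u).surjOn h
    exact hinj h' ▸ hw'
  · exact (hfb u).mapsTo h

lemma isPeriodicColoring_of_labelling {A : Type*} [Finite L] (hT : T.IsTree) {l : V → L}
    (hl : ∀ u u', l u = l u' → NeighborMatch T l l u u') (c : L → A) :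
    IsPeriodicColoring T (c ∘ l) := by
  let Γ : Subgroup (Equiv.Perm V) :=
    { carrier := {γ | (∀ u w, T.Adj (γ u) (γ w) ↔ T.Adj u w) ∧ ∀ v, l (γ v) = l v}
      mul_mem' := fun {γ δ} hγ hδ =>
        ⟨fun u w => by rw [Equiv.Perm.mul_apply, Equiv.Perm.mul_apply, hγ.1, hδ.1],
          fun v => by rw [Equiv.Perm.mul_apply, hγ.2, hδ.2]⟩
      one_mem' := ⟨fun _ _ => Iff.rfl, fun _ => rfl⟩
      inv_mem' := fun {γ} hγ =>
        ⟨fun u w => by rw [← hγ.1]; simp, fun v => by rw [← hγ.2]; simp⟩ }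
  refine ⟨Γ, fun γ hγ => hγ.1, fun γ hγ v => congrArg c (hγ.2 v), ?_⟩
  refine Finite.of_injective
    (Quot.lift l (by rintro _ _ ⟨γ, hγ, rfl⟩; exact (hγ.2 _).symm) : Quot _ → L) ?_
  rintro ⟨x⟩ ⟨y⟩ h
  obtain ⟨γ, h1, h2, h3⟩ := exists_automorphism hT hl (x := x) (y := y) h
  exact Quot.sound ⟨γ, ⟨h1, h2⟩, h3⟩

/-- A labelling whose restriction to a set `G` closed under taking parents is locally determined by
labels extends from `G` to a labelling of the whole regular tree that is locally determined. -/
lemma exists_labelling_extension {k : ℕ} (hT : T.IsTree) (hk : 0 < k)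
    (hreg : ∀ v : V, (T.neighborSet v).ncard = k) {j : V → L} {good G : Set V} {v : V}
    (hgood : ∀ u ∈ good, ∀ u' ∈ good, j u = j u' → NeighborMatch T j j u u')
    (hedge : ∀ u ∈ good, ∀ w, T.Adj u w →
      ∃ u' ∈ good, ∃ w' ∈ good, T.Adj u' w' ∧ j u' = j u ∧ j w' = j w)
    (hG : G ⊆ good) (hv : v ∈ G)
    (hpar : ∀ u ∈ G, ∀ p, T.Adj p u → T.dist v u = T.dist v p + 1 → p ∈ G) :
    ∃ l : V → L, (∀ u ∈ G, l u = j u) ∧ ∀ u u', l u = l u' → NeighborMatch T l l u u' := by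
  classical
  have hc := hT.connected
  let Adm : L → L → Prop := fun a b =>
    ∃ r ∈ good, ∃ s ∈ good, T.Adj r s ∧ j r = a ∧ j s = b
  have hAdm : ∀ a b, Adm a b → Adm b a := fun a b ⟨r, hr, s, hs, h, ha, hb⟩ =>
    ⟨s, hs, r, hr, h.symm, hb, ha⟩
  have hσ : ∀ p a b, ∃ σ : V → V, Adm a b → ∃ r ∈ good, j r = a ∧
      Set.BijOn σ (T.neighborSet p) (T.neighborSet r) ∧
      ∀ q, T.Adj q p → T.dist v p = T.dist v q + 1 → j (σ q) = b := by
    intro p a b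
    by_cases hab : Adm a b
    swap
    · exact ⟨id, fun h => absurd h hab⟩
    obtain ⟨r, hr, s, hs, hrs, ha, hb⟩ := hab
    have : Nonempty V := ⟨v⟩
    have hcard : (T.neighborSet p).encard = (T.neighborSet r).encard := by
      rw [← (finite_neighborSet hk hreg p).cast_ncard_eq,
        ← (finite_neighborSet hk hreg r).cast_ncard_eq, hreg, hreg]
    obtain ⟨σ, hσ⟩ := (finite_neighborSet hk hreg p).exists_bijOn_of_encard_eq hcard
    by_cases hpv : p = v
    · subst hpv
      exact ⟨σ, fun _ => ⟨r, hr, ha, hσ, fun q _ hd => by simp at hd⟩⟩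
    obtain ⟨q, hq, hdq⟩ := exists_parent hc hpv
    obtain ⟨ρ, hρ, hρq, -⟩ := exists_bijOn_swap (L := L) hσ (q := q) (q' := s) hq.symm hrs
    refine ⟨ρ, fun _ => ⟨r, hr, ha, hρ, fun q₁ hq₁ hd₁ => ?_⟩⟩
    rw [parent_unique hT hq₁ hq hd₁ hdq, hρq, hb]
  choose σ hσ using hσ
  obtain ⟨g, hgv, hg⟩ := exists_parent_rec hT v (j v, j v)
    fun p u (s : L × L) => (if p ∈ G then j u else j (σ p s.1 s.2 u), s.1)
  let l : V → L := fun u => (g u).1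
  have hl2 : ∀ p u, T.Adj p u → T.dist v u = T.dist v p + 1 → (g u).2 = l p := fun p u hp hd =>
    congrArg Prod.snd (hg p u hp hd)
  have hchildG : ∀ p u, T.Adj p u → T.dist v u = T.dist v p + 1 → p ∈ G → l u = j u :=
    fun p u hp hd hpG => (congrArg Prod.fst (hg p u hp hd)).trans (if_pos hpG)
  have hchild : ∀ p u, T.Adj p u → T.dist v u = T.dist v p + 1 → p ∉ G →
      l u = j (σ p (l p) (g p).2 u) :=
    fun p u hp hd hpG => (congrArg Prod.fst (hg p u hp hd)).trans (if_neg hpG)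
  have hlG : ∀ u ∈ G, l u = j u := by
    intro u hu
    by_cases hne : u = v
    · subst hne
      simp only [l, hgv]
    · obtain ⟨p, hp, hd⟩ := exists_parent hc hne
      exact hchildG p u hp hd (hpar u hu p hp hd)
  have hadm : ∀ n u p, T.dist v u = n → T.Adj p u → T.dist v u = T.dist v p + 1 →
      Adm (l u) (l p) := by
    intro n
    induction n with
    | zero => intro u p h1 _ h2; omega
    | succ n ih =>
      intro u p h1 hp hd
      apply hAdm
      by_cases hpG : p ∈ G
      · rw [hlG p hpG, hchildG p u hp hd hpG]
        exact hedge p (hG hpG) u hp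
      · have hne : p ≠ v := fun h => hpG (h ▸ hv)
        obtain ⟨q, hq, hdq⟩ := exists_parent hc hne
        obtain ⟨r, hr, hrp, hb, -⟩ := hσ p (l p) (g p).2
          (by rw [hl2 q p hq hdq]; exact ih p q (by omega) hq hdq)
        rw [hchild p u hp hd hpG, ← hrp]
        exact hedge r hr _ (hrp ▸ hb.mapsTo hp)
  have hlocal : ∀ p, ∃ r ∈ good, j r = l p ∧ NeighborMatch T l j p r := by
    intro p
    by_cases hpG : p ∈ G
    · refine ⟨p, hG hpG, (hlG p hpG).symm, id, Set.bijOn_id _, fun w hw => ?_⟩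
      rcases hT.dist_eq_dist_add_one_of_adj v hw with h | h
      · exact (hlG w (hpar p hpG w hw.symm h)).symm
      · exact (hchildG p w hw h hpG).symm
    · have hne : p ≠ v := fun h => hpG (h ▸ hv)
      obtain ⟨q, hq, hdq⟩ := exists_parent hc hne
      obtain ⟨r, hr, hrp, hb, hbq⟩ := hσ p (l p) (g p).2
        (by rw [hl2 q p hq hdq]; exact hadm _ p q rfl hq hdq)
      refine ⟨r, hr, hrp, _, hb, fun w hw => ?_⟩
      rcases hT.dist_eq_dist_add_one_of_adj v hw with h | h
      · rw [hbq w hw.symm h, hl2 w p hw.symm h]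
      · exact (hchild p w hw h hpG).symm
  refine ⟨l, hlG, fun u u' h => ?_⟩
  obtain ⟨r, hr, hru, hm⟩ := hlocal u
  obtain ⟨r', hr', hru', hm'⟩ := hlocal u'
  exact (hm.trans (hgood r hr r' hr' (by rw [hru, hru', h]))).trans hm'.symm

end Labelling

section Sturmian

variable {V A : Type*} {T : SimpleGraph V} {φ : V → A} {k : ℕ}

lemma _root_.BallEquiv.mono (hc : T.Connected) (hk : 0 < k)
    (hreg : ∀ v : V, (T.neighborSet v).ncard = k) {m n : ℕ} (hmn : m ≤ n) {x y : V}
    (h : BallEquiv T φ n x y) : BallEquiv T φ m x y := by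
  obtain ⟨f, rfl, hinj, hadj, hφ⟩ := BallEquiv.exists_map h
  exact ballEquiv_of_map hc hk hreg hinj hadj hφ fun v hv => le_trans hv hmn

lemma _root_.BallEquiv.exists_bijOn_neighborSet (hc : T.Connected) (hk : 0 < k)
    (hreg : ∀ v : V, (T.neighborSet v).ncard = k) {n : ℕ} {x y : V}
    (h : BallEquiv T φ (n + 1) x y) :
    ∃ f : V → V, Set.BijOn f (T.neighborSet x) (T.neighborSet y) ∧
      ∀ w ∈ T.neighborSet x, BallEquiv T φ n w (f w) := by
  obtain ⟨f, rfl, hinj, hadj, hφ⟩ := BallEquiv.exists_map h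
  have hN : T.neighborSet x ⊆ {v | T.dist x v ≤ n + 1} := fun w hw => by
    have : T.dist x w = 1 := dist_eq_one_iff_adj.2 hw
    exact this.le.trans (by omega)
  have himg : f '' T.neighborSet x = T.neighborSet (f x) := by
    apply Set.eq_of_subset_of_ncard_le
    · rintro _ ⟨w, hw, rfl⟩
      exact (hadj x (by simp) w (hN hw)).1 hw
    · rw [hreg, (hinj.mono hN).ncard_image, hreg]
    · exact finite_neighborSet hk hreg _
  refine ⟨f, himg ▸ (hinj.mono hN).bijOn_image, fun w hw => ?_⟩
  refine ballEquiv_of_map hc hk hreg hinj hadj hφ fun v hv => ?_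
  have h1 : T.dist x w = 1 := dist_eq_one_iff_adj.2 hw
  have h2 := hc.dist_triangle (u := x) (v := w) (w := v)
  have h3 : T.dist w v ≤ n := hv
  exact h2.trans (by omega)

lemma finite_class_succ_of_adj (hc : T.Connected) (hk : 0 < k)
    (hreg : ∀ v : V, (T.neighborSet v).ncard = k) {n : ℕ} {x w : V}
    (h : {y | BallEquiv T φ n x y}.Finite) (hxw : T.Adj x w) :
    {y | BallEquiv T φ (n + 1) w y}.Finite := by
  refine (h.biUnion fun y _ => finite_neighborSet hk hreg y).subset fun y hy => ?_
  obtain ⟨f, hf, hfn⟩ := BallEquiv.exists_bijOn_neighborSet hc hk hreg hy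
  exact Set.mem_biUnion (hfn x hxw.symm) (hf.mapsTo hxw.symm).symm

lemma finite_class_congr {n : ℕ} {x y : V} (hxy : BallEquiv T φ n x y)
    (h : {z | BallEquiv T φ n x z}.Finite) : {z | BallEquiv T φ n y z}.Finite :=
  h.subset fun _ hz => hxy.trans hz

lemma isSturmian_finite_quot (hst : IsSturmian T φ) (n : ℕ) :
    Finite (Quot (BallEquiv T φ n)) :=
  Nat.finite_of_card_ne_zero (by
    have h : Nat.card (Quot (BallEquiv T φ n)) = n + 2 := hst n
    omega)

lemma isSturmian_infinite (hst : IsSturmian T φ) : Infinite V := by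
  by_contra h
  have : Finite V := not_infinite_iff_finite.1 h
  have h1 := Nat.card_le_card_of_surjective (Quot.mk (BallEquiv T φ (Nat.card V)))
    Quot.mk_surjective
  have h2 : Nat.card (Quot (BallEquiv T φ (Nat.card V))) = Nat.card V + 2 := hst _
  omega

lemma finite_setOf_finite_class (hst : IsSturmian T φ) (n : ℕ) :
    {x | {y | BallEquiv T φ n x y}.Finite}.Finite := by
  have := isSturmian_finite_quot hst n
  have hfib : ∀ q : Quot (BallEquiv T φ n),
      {x | {y | BallEquiv T φ n x y}.Finite ∧ Quot.mk _ x = q}.Finite := by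
    intro q
    by_cases h : ∃ x, {y | BallEquiv T φ n x y}.Finite ∧ Quot.mk _ x = q
    · obtain ⟨x, hx, rfl⟩ := h
      refine hx.subset fun y hy => ?_
      exact ((ballEquiv_equivalence n).quot_mk_eq_iff _ _).1 hy.2.symm
    · push Not at h
      convert Set.finite_empty
      exact Set.eq_empty_of_forall_notMem fun x hx => h x hx.1 hx.2
  refine (Set.finite_iUnion hfib).subset fun x hx => ?_
  exact Set.mem_iUnion.2 ⟨Quot.mk _ x, hx, rfl⟩

/-- Once some class of `n`-balls is finite, the infinite classes of `(n + 1)`-balls are determined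
by the `n`-balls they contain. -/
lemma ballEquiv_succ_of_infinite_class (hc : T.Connected) (hk : 0 < k)
    (hreg : ∀ v : V, (T.neighborSet v).ncard = k) (hst : IsSturmian T φ) {n : ℕ} {x₀ : V}
    (hx₀ : {y | BallEquiv T φ n x₀ y}.Finite) {x y : V}
    (hx : {z | BallEquiv T φ (n + 1) x z}.Infinite)
    (hy : {z | BallEquiv T φ (n + 1) y z}.Infinite) (hxy : BallEquiv T φ n x y) :
    BallEquiv T φ (n + 1) x y := by
  classical
  have hU := finite_setOf_finite_class hst (φ := φ) (T := T)
  have hinfV := isSturmian_infinite hst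
  have := isSturmian_finite_quot hst n
  have := isSturmian_finite_quot hst (n + 1)
  obtain ⟨a, w, haw, ha, hw⟩ : ∃ a w, T.Adj a w ∧ {z | BallEquiv T φ n a z}.Finite ∧
      {z | BallEquiv T φ n w z}.Infinite := by
    by_contra! hcl
    refine Set.infinite_univ (α := V) ((hU n).subset fun u _ => ?_)
    obtain ⟨W⟩ := hc.preconnected x₀ u
    change {z | BallEquiv T φ n u z}.Finite
    clear * - W hx₀ hcl
    induction W with
    | nil => exact hx₀
    | cons hadj _ ih => exact ih (by simpa using hcl _ _ hadj hx₀)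
  have hw' : {z | BallEquiv T φ (n + 1) w z}.Finite :=
    finite_class_succ_of_adj hc hk hreg ha haw
  have hs : ∀ q : Quot (BallEquiv T φ n), ∃ u, Quot.mk _ u = q ∧
      ({z | BallEquiv T φ n u z}.Infinite → {z | BallEquiv T φ (n + 1) u z}.Infinite) := by
    intro q
    obtain ⟨u, rfl⟩ := Quot.exists_rep q
    by_cases hu : {z | BallEquiv T φ n u z}.Infinite
    · obtain ⟨z, hz, hzU⟩ := hu.exists_notMem_finite (hU (n + 1))
      exact ⟨z, (Quot.sound hz).symm, fun _ => hzU⟩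
    · exact ⟨u, rfl, fun h => absurd h hu⟩
  choose s hsq hsinf using hs
  let S : Quot (BallEquiv T φ n) → Quot (BallEquiv T φ (n + 1)) := fun q => Quot.mk _ (s q)
  have hmk : ∀ m (u v : V), Quot.mk (BallEquiv T φ m) u = Quot.mk _ v → BallEquiv T φ m u v :=
    fun m u v h => ((ballEquiv_equivalence m).quot_mk_eq_iff _ _).1 h
  have hSinj : Function.Injective S := fun q q' h => by
    rw [← hsq q, ← hsq q']
    exact Quot.sound (BallEquiv.mono hc hk hreg (Nat.le_succ n) (hmk _ _ _ h))
  have hSw : ∀ q, S q ≠ Quot.mk _ w := fun q h => by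
    have h1 := hmk _ _ _ h
    have h2 := BallEquiv.mono hc hk hreg (Nat.le_succ n) h1
    have h3 : {z | BallEquiv T φ n (s q) z}.Infinite := fun hf => hw (finite_class_congr h2 hf)
    exact hsinf q h3 (finite_class_congr h1.symm hw')
  have hrange : Set.range S = {Quot.mk _ w}ᶜ := by
    apply Set.eq_of_subset_of_ncard_le
    · rintro _ ⟨q, rfl⟩
      exact hSw q
    · have h1 : Nat.card (Quot (BallEquiv T φ n)) = n + 2 := hst n
      have h2 : Nat.card (Quot (BallEquiv T φ (n + 1))) = n + 1 + 2 := hst (n + 1)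
      have h3 := Set.ncard_add_ncard_compl {(Quot.mk _ w : Quot (BallEquiv T φ (n + 1)))}
      rw [Set.ncard_singleton] at h3
      rw [← Set.image_univ, Set.ncard_image_of_injective _ hSinj, Set.ncard_univ]
      omega
    · exact Set.toFinite _
  have key : ∀ u, {z | BallEquiv T φ (n + 1) u z}.Infinite →
      BallEquiv T φ (n + 1) (s (Quot.mk _ u)) u := by
    intro u hu
    have hne : Quot.mk (BallEquiv T φ (n + 1)) u ∈ ({Quot.mk _ w}ᶜ : Set _) := fun h =>
      hu (finite_class_congr (hmk _ _ _ h).symm hw')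
    rw [← hrange] at hne
    obtain ⟨q, hq⟩ := hne
    have h1 := hmk _ _ _ hq
    have h2 : q = Quot.mk _ u := by
      rw [← hsq q]
      exact Quot.sound (BallEquiv.mono hc hk hreg (Nat.le_succ n) h1)
    rwa [← h2]
  have hx' := key x hx
  rw [Quot.sound hxy] at hx'
  exact hx'.symm.trans (key y hy)

lemma isEventuallyPeriodic_of_finite_class (hT : T.IsTree) (hk : 0 < k)
    (hreg : ∀ v : V, (T.neighborSet v).ncard = k) (hst : IsSturmian T φ) {n : ℕ} {x₀ : V}
    (hx₀ : {y | BallEquiv T φ n x₀ y}.Finite) : IsEventuallyPeriodic T φ := by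
  classical
  have hc := hT.connected
  have hU := finite_setOf_finite_class hst (n + 1)
  have := isSturmian_finite_quot hst n
  have hx₀' : {y | BallEquiv T φ (n + 1) x₀ y}.Finite :=
    hx₀.subset fun y hy => BallEquiv.mono hc hk hreg (Nat.le_succ n) hy
  obtain ⟨K, hUK, hKc⟩ := extend_finset_to_connected hc.preconnected (t := hU.toFinset)
    ⟨x₀, by simpa using hx₀'⟩
  refine ⟨K, ⟨x₀, hUK (by simpa using hx₀')⟩, K.finite_toSet, hKc, ?_⟩
  rintro ⟨v, hv⟩
  let j : V → Quot (BallEquiv T φ n) := Quot.mk _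
  have hj : ∀ u w, j u = j w → BallEquiv T φ n u w :=
    fun u w h => ((ballEquiv_equivalence n).quot_mk_eq_iff _ _).1 h
  let good : Set V := {u | {y | BallEquiv T φ (n + 1) u y}.Infinite}
  let G : Set V := {u | ∃ hu : u ∈ (K : Set V)ᶜ,
    (T.induce (K : Set V)ᶜ).Reachable ⟨v, hv⟩ ⟨u, hu⟩}
  have hmatch : ∀ u u', BallEquiv T φ (n + 1) u u' → NeighborMatch T j j u u' := by
    intro u u' h
    obtain ⟨f, hf, hfn⟩ := BallEquiv.exists_bijOn_neighborSet hc hk hreg h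
    exact ⟨f, hf, fun w hw => (Quot.sound (hfn w hw)).symm⟩
  have hgood : ∀ u ∈ good, ∀ u' ∈ good, j u = j u' → NeighborMatch T j j u u' :=
    fun u hu u' hu' h => hmatch u u'
      (ballEquiv_succ_of_infinite_class hc hk hreg hst hx₀ hu hu' (hj _ _ h))
  have hedge : ∀ u ∈ good, ∀ w, T.Adj u w →
      ∃ u' ∈ good, ∃ w' ∈ good, T.Adj u' w' ∧ j u' = j u ∧ j w' = j w := by
    intro u hu w huw
    obtain ⟨u', hu', hu'N⟩ := Set.Infinite.exists_notMem_finite hu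
      (hU.biUnion fun a _ => finite_neighborSet hk hreg a)
    obtain ⟨f, hf, hfn⟩ := BallEquiv.exists_bijOn_neighborSet hc hk hreg hu'
    have hadj : T.Adj u' (f w) := hf.mapsTo huw
    refine ⟨u', fun h => hu (finite_class_congr (BallEquiv.symm hu') h), f w, fun h => hu'N ?_,
      hadj, (Quot.sound (BallEquiv.mono hc hk hreg (Nat.le_succ n) hu')).symm,
      (Quot.sound (hfn w huw)).symm⟩
    exact Set.mem_biUnion h hadj.symm
  have hG : G ⊆ good := by
    rintro u ⟨hu, -⟩ h
    exact hu (hUK (by simpa using h))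
  obtain ⟨l, hlG, hl⟩ := exists_labelling_extension hT hk hreg hgood hedge hG
    (v := v) ⟨hv, Reachable.refl _⟩ fun u hu p hp hd => by
      obtain ⟨hu, hr⟩ := hu
      exact parent_mem hT hr hp hd
  have hcol : ∀ u w, BallEquiv T φ n u w → φ u = φ w := by
    intro u w h
    obtain ⟨f, rfl, -, -, hφ⟩ := BallEquiv.exists_map h
    exact (hφ u (by simp)).symm
  refine ⟨Quot.lift φ hcol ∘ l, isPeriodicColoring_of_labelling hT hl _, fun w hw => ?_⟩
  rw [Function.comp_apply, hlG w ⟨w.2, hw⟩]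

end Sturmian

end SturmianTree

theorem stmt_14 {V A : Type*} (T : SimpleGraph V) (φ : V → A) (k : ℕ)
    (hk : 2 ≤ k) (htree : T.IsTree) (hreg : ∀ v : V, (T.neighborSet v).ncard = k)
    (hst : IsSturmian T φ) :
    IsEventuallyPeriodic T φ ↔
      ∃ K : Set V, K.Nonempty ∧ K.Finite ∧ (T.induce K).Connected ∧
        AppearsOnce T φ K := by
  have hk' : 0 < k := by omega
  constructor
  · intro h
    obtain ⟨n, x, hx⟩ :=
      SturmianTree.exists_finite_class_of_isEventuallyPeriodic htree hk' hreg hst h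
    exact SturmianTree.exists_appearsOnce_of_finite_class htree hk' hreg hx
  · rintro ⟨K, hne, hfin, hconn, honce⟩
    obtain ⟨n, x, hx⟩ := SturmianTree.exists_finite_class_of_appearsOnce hne hfin hconn honce
    exact SturmianTree.isEventuallyPeriodic_of_finite_class htree hk' hreg hst hx
end

section
/- Suppose φ is a Sturmian, eventually periodic coloring of the k-regular tree T (so every vertex has a finite type set), and let m = min{τ(x) : x ∈ V(T)}. Then: (i) every vertex x with τ(x) > m has exactly one neighbor of maximal type τ(x) − 1, exactly k − 1 neighbors of maximal type τ(x) + 1, and no neighbor of maximal type τ(x); (ii) every vertex x with τ(x) = m has at most one neighbor of maximal type m, and all its remaining neighbors have maximal type m + 1; in particular either all k neighbors of x have maximal type m + 1, or exactly one neighbor has maximal type m and the other k − 1 neighbors have maximal type m + 1. -/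
open SimpleGraph

/-- Iterated color refinement: `x` and `y` are identified at step `n + 1` if they have the same
color and their neighbors can be matched so that matched vertices are identified at step `n`. -/
def RefineEquiv {V A : Type*} (T : SimpleGraph V) (φ : V → A) : ℕ → V → V → Prop
  | 0, x, y => φ x = φ y
  | n + 1, x, y => φ x = φ y ∧ ∃ σ : T.neighborSet x ≃ T.neighborSet y,
      ∀ w : T.neighborSet x, RefineEquiv T φ n w (σ w)

namespace RefineEquiv

variable {V A : Type*} {T : SimpleGraph V} {φ : V → A}

theorem color_eq {n : ℕ} {x y : V} (h : RefineEquiv T φ n x y) : φ x = φ y := by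
  cases n with
  | zero => exact h
  | succ n => exact h.1

theorem refl (n : ℕ) (x : V) : RefineEquiv T φ n x x := by
  induction n generalizing x with
  | zero => exact Eq.refl _
  | succ n ih => exact ⟨Eq.refl _, Equiv.refl _, fun w => ih w⟩

theorem symm {n : ℕ} {x y : V} (h : RefineEquiv T φ n x y) : RefineEquiv T φ n y x := by
  induction n generalizing x y with
  | zero => exact Eq.symm h
  | succ n ih =>
    obtain ⟨hc, σ, hσ⟩ := h
    refine ⟨hc.symm, σ.symm, fun w => ih ?_⟩
    simpa using hσ (σ.symm w)

theorem trans {n : ℕ} {x y z : V} (h : RefineEquiv T φ n x y) (h' : RefineEquiv T φ n y z) :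
    RefineEquiv T φ n x z := by
  induction n generalizing x y z with
  | zero => exact Eq.trans h h'
  | succ n ih =>
    obtain ⟨hc, σ, hσ⟩ := h
    obtain ⟨hc', σ', hσ'⟩ := h'
    exact ⟨hc.trans hc', σ.trans σ', fun w => ih (hσ w) (hσ' (σ w))⟩

theorem of_succ {n : ℕ} {x y : V} (h : RefineEquiv T φ (n + 1) x y) : RefineEquiv T φ n x y := by
  induction n generalizing x y with
  | zero => exact h.1
  | succ n ih =>
    obtain ⟨hc, σ, hσ⟩ := h
    exact ⟨hc, σ, fun w => ih (hσ w)⟩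

theorem mono {m n : ℕ} (hmn : m ≤ n) {x y : V} (h : RefineEquiv T φ n x y) :
    RefineEquiv T φ m x y := by
  induction n, hmn using Nat.le_induction with
  | base => exact h
  | succ n _ ih => exact ih h.of_succ

/-- The matching of neighbors can be chosen to match two prescribed equivalent neighbors. -/
theorem exists_equiv_apply_eq {n : ℕ} {x y : V} (h : RefineEquiv T φ (n + 1) x y)
    (p : T.neighborSet x) (q : T.neighborSet y) (hpq : RefineEquiv T φ n p q) :
    ∃ σ : T.neighborSet x ≃ T.neighborSet y,
      (∀ w : T.neighborSet x, RefineEquiv T φ n w (σ w)) ∧ σ p = q := by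
  classical
  obtain ⟨-, σ, hσ⟩ := h
  refine ⟨σ.trans (Equiv.swap (σ p) q), fun w => ?_, by simp⟩
  rw [Equiv.trans_apply, Equiv.swap_apply_def]
  split_ifs with h1 h2
  · rw [σ.injective h1]
    exact hpq
  · exact (h2 ▸ hσ w).trans (hpq.symm.trans (hσ p))
  · exact hσ w

end RefineEquiv

namespace SimpleGraph.IsTree

variable {V : Type*} {T : SimpleGraph V}

/-- In a rooted tree a vertex has at most one neighbor that is no further from the root. -/
theorem eq_of_adj_of_dist_le (hT : T.IsTree) {x u w w' : V} (hw : T.Adj w u) (hw' : T.Adj w' u)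
    (hd : T.dist x w ≤ T.dist x u) (hd' : T.dist x w' ≤ T.dist x u) : w = w' := by
  have key : ∀ w : V, T.Adj w u → T.dist x w ≤ T.dist x u →
      ∃ p : T.Walk x u, p.IsPath ∧ p.penultimate = w := by
    intro w hw hd
    obtain ⟨q, hq⟩ := hT.connected.exists_walk_length_eq_dist x w
    refine ⟨q.concat hw, Walk.isPath_of_length_eq_dist _ ?_, by simp⟩
    have := hT.dist_eq_dist_add_one_of_adj x hw
    rw [Walk.length_concat]
    omega
  obtain ⟨p, hp, rfl⟩ := key w hw hd
  obtain ⟨p', hp', rfl⟩ := key w' hw' hd'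
  rw [(hT.existsUnique_path x u).unique hp hp']

theorem exists_adj_dist_add_one (hT : T.IsTree) {x v : V} (h : T.dist x v ≠ 0) :
    ∃ u, T.Adj u v ∧ T.dist x u + 1 = T.dist x v := by
  obtain ⟨p, hp⟩ := hT.connected.exists_walk_length_eq_dist x v
  have hn : ¬ p.Nil := fun hn => h (by rw [← hp]; exact Walk.length_eq_zero_iff.2 hn)
  refine ⟨p.penultimate, p.adj_penultimate hn, ?_⟩
  have h1 := T.dist_le p.dropLast
  have h2 := hT.dist_eq_dist_add_one_of_adj x (p.adj_penultimate hn)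
  have h3 := p.length_dropLast
  omega

end SimpleGraph.IsTree

theorem BallEquiv.refineEquiv {V A : Type*} {T : SimpleGraph V} {φ : V → A} {k : ℕ}
    (hT : T.IsTree) (hk : k ≠ 0) (hreg : ∀ v : V, (T.neighborSet v).ncard = k) {n : ℕ} {x y : V}
    (h : BallEquiv T φ n x y) : RefineEquiv T φ n x y := by
  obtain ⟨f, hfx, hadj, hcol⟩ := h
  have hfin (v : V) : Finite (T.neighborSet v) := Set.finite_of_ncard_ne_zero (by rw [hreg]; exact hk)
  have key : ∀ j (u : {v : V // T.dist x v ≤ n}), T.dist x u + j ≤ n →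
      RefineEquiv T φ j u (f u) := by
    intro j
    induction j with
    | zero => exact fun u _ => (hcol u).symm
    | succ j ih =>
      intro u hu
      have hball (w : T.neighborSet u) : T.dist x w ≤ T.dist x u + 1 := by
        have hw : T.Adj u w := w.2
        have := hT.connected.dist_triangle (u := x) (v := u) (w := w)
        rwa [dist_eq_one_iff_adj.2 hw] at this
      let e (w : T.neighborSet u) : {v : V // T.dist x v ≤ n} := ⟨w, by have := hball w; omega⟩
      let g (w : T.neighborSet u) : T.neighborSet (f u : V) := ⟨f (e w), (hadj u (e w)).1 w.2⟩
      have hg : Function.Injective g := fun a b hab => by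
        have hg_eq : (g a : V) = g b := by rw [hab]
        have hfe : f (e a) = f (e b) := Subtype.ext hg_eq
        have he : (e a : V) = e b := by rw [f.injective hfe]
        exact Subtype.ext he
      have hbij : Function.Bijective g := by
        refine (Nat.bijective_iff_injective_and_card g).2 ⟨hg, ?_⟩
        rw [Nat.card_coe_set_eq, Nat.card_coe_set_eq, hreg, hreg]
      refine ⟨(hcol u).symm, Equiv.ofBijective g hbij, fun w => ih (e w) ?_⟩
      have := hball w
      change T.dist x w + j ≤ n
      omega
  have := key n ⟨x, by simp⟩ (by simp)
  rwa [hfx] at this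

/-- `f` is a ball isomorphism of radius `n` from `x` to `y`, moving each vertex to one that is
equivalent to it up to the horizon `N`. -/
structure IsPartialBallIso {V A : Type*} (T : SimpleGraph V) (φ : V → A) (N n : ℕ) (x y : V)
    (f : V → V) : Prop where
  map_center : f x = y
  dist_map : ∀ u, T.dist x u ≤ n → T.dist y (f u) = T.dist x u
  refineEquiv : ∀ u, T.dist x u ≤ n → RefineEquiv T φ (N - T.dist x u) u (f u)
  map_adj : ∀ u w, T.dist x u ≤ n → T.dist x w ≤ n → T.Adj u w → T.Adj (f u) (f w)
  injOn : ∀ u w, T.dist x u ≤ n → T.dist x w ≤ n → f u = f w → u = w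
  surjOn : ∀ v, T.dist y v ≤ n → ∃ u, T.dist x u ≤ n ∧ f u = v

namespace IsPartialBallIso

variable {V A : Type*} {T : SimpleGraph V} {φ : V → A} {N n : ℕ} {x y : V} {f : V → V}

/-- A partial ball isomorphism matches the neighbors of each vertex on the boundary sphere. -/
theorem exists_equiv (hT : T.IsTree) (hn : n + 1 ≤ N) (hf : IsPartialBallIso T φ N n x y f)
    {u : V} (hu : T.dist x u = n) :
    ∃ σ : T.neighborSet u ≃ T.neighborSet (f u),
      (∀ w : T.neighborSet u, RefineEquiv T φ (N - (n + 1)) w (σ w)) ∧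
      ∀ w : T.neighborSet u, T.dist x w ≤ n → (σ w : V) = f w := by
  have hR := hf.refineEquiv u hu.le
  rw [show N - T.dist x u = N - (n + 1) + 1 by omega] at hR
  by_cases h : ∃ p : T.neighborSet u, T.dist x p ≤ n
  · obtain ⟨p, hp⟩ := h
    obtain ⟨σ, hσ, hσp⟩ := hR.exists_equiv_apply_eq p ⟨f p, hf.map_adj u p hu.le hp p.2⟩
      ((hf.refineEquiv p hp).mono (by omega))
    refine ⟨σ, hσ, fun w hw => ?_⟩
    have : w = p := Subtype.ext (hT.eq_of_adj_of_dist_le (x := x) (T.adj_symm w.2) (T.adj_symm p.2)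
      (hw.trans hu.ge) (hp.trans hu.ge))
    rw [this, hσp]
  · obtain ⟨-, σ, hσ⟩ := hR
    exact ⟨σ, hσ, fun w hw => absurd ⟨w, hw⟩ h⟩

theorem exists_succ (hT : T.IsTree) (hn : n + 1 ≤ N) (hf : IsPartialBallIso T φ N n x y f) :
    ∃ g, IsPartialBallIso T φ N (n + 1) x y g := by
  have hpar : ∀ v : V, ∃ u, T.dist x v = n + 1 → T.Adj u v ∧ T.dist x u = n := fun v => by
    by_cases hv : T.dist x v = n + 1
    · obtain ⟨u, hu, hd⟩ := hT.exists_adj_dist_add_one (x := x) (v := v) (by omega)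
      exact ⟨u, fun _ => ⟨hu, by omega⟩⟩
    · exact ⟨v, fun h => absurd h hv⟩
  choose par hpar using hpar
  have hσ : ∀ u : V, ∃ σ : V → V, T.dist x u = n →
      (∀ w, T.Adj u w → T.Adj (f u) (σ w)) ∧
      (∀ w, T.Adj u w → RefineEquiv T φ (N - (n + 1)) w (σ w)) ∧
      (∀ w, T.Adj u w → T.dist x w ≤ n → σ w = f w) ∧
      (∀ w w', T.Adj u w → T.Adj u w' → σ w = σ w' → w = w') ∧
      ∀ z, T.Adj (f u) z → ∃ w, T.Adj u w ∧ σ w = z := fun u => by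
    classical
    by_cases hu : T.dist x u = n
    · obtain ⟨σ, h1, h2⟩ := hf.exists_equiv hT hn hu
      have hs (w : V) (hw : T.Adj u w) :
          (if h : T.Adj u w then (σ ⟨w, h⟩ : V) else w) = σ ⟨w, hw⟩ := dif_pos hw
      refine ⟨fun w => if h : T.Adj u w then σ ⟨w, h⟩ else w, fun _ =>
        ⟨fun w hw => ?_, fun w hw => ?_, fun w hw => ?_, fun w w' hw hw' => ?_, fun z hz => ?_⟩⟩
      · simp only [hs w hw]
        exact (σ ⟨w, hw⟩).2
      · simp only [hs w hw]
        exact h1 ⟨w, hw⟩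
      · simp only [hs w hw]
        exact h2 ⟨w, hw⟩
      · simp only [hs w hw, hs w' hw']
        exact fun h => congrArg Subtype.val (σ.injective (Subtype.ext h))
      · refine ⟨σ.symm ⟨z, hz⟩, (σ.symm ⟨z, hz⟩).2, ?_⟩
        have := hs (σ.symm ⟨z, hz⟩) (σ.symm ⟨z, hz⟩).2
        simp only [this, Subtype.coe_eta, Equiv.apply_symm_apply]
    · exact ⟨id, fun h => absurd h hu⟩
  choose σ hσ using hσ
  classical
  let g : V → V := fun v => if T.dist x v = n + 1 then σ (par v) v else f v
  have g_old (v : V) (hv : T.dist x v ≤ n) : g v = f v := if_neg (by omega)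
  have g_new (v : V) (hv : T.dist x v = n + 1) : g v = σ (par v) v := if_pos hv
  have par_eq {u v : V} (hv : T.dist x v = n + 1) (hu : T.dist x u ≤ n) (h : T.Adj u v) :
      par v = u :=
    hT.eq_of_adj_of_dist_le (x := x) (hpar v hv).1 h (by have := (hpar v hv).2; omega) (by omega)
  have g_adj {v : V} (hv : T.dist x v = n + 1) : T.Adj (f (par v)) (g v) := by
    rw [g_new v hv]
    exact (hσ _ (hpar v hv).2).1 v (hpar v hv).1
  have g_dist {v : V} (hv : T.dist x v = n + 1) : T.dist y (g v) = n + 1 := by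
    have hp := (hpar v hv).2
    have hfp := hf.dist_map (par v) hp.le
    have hs := hT.dist_eq_dist_add_one_of_adj y (g_adj hv)
    rcases hs with hs | hs
    · exfalso
      have hn0 : n ≠ 0 := by omega
      obtain ⟨q, hq, hqd⟩ := hT.exists_adj_dist_add_one (x := x) (v := par v) (by omega)
      have hfq := hf.map_adj q (par v) (by omega) (by omega) hq
      have hdq := hf.dist_map q (by omega)
      have h1 : f q = g v := hT.eq_of_adj_of_dist_le (x := y) hfq (g_adj hv).symm
        (by omega) (by omega)
      obtain ⟨-, -, h3, h4, -⟩ := hσ (par v) hp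
      rw [← h3 q hq.symm (by omega), g_new v hv] at h1
      have := h4 q v hq.symm (hpar v hv).1 h1
      rw [this] at hqd
      omega
    · omega
  have cases_dist {v : V} (hv : T.dist x v ≤ n + 1) : T.dist x v ≤ n ∨ T.dist x v = n + 1 := by
    omega
  have adj_aux {u w : V} (hu : T.dist x u ≤ n) (hw : T.dist x w = n + 1) (h : T.Adj u w) :
      T.Adj (g u) (g w) := by
    have := g_adj hw
    rwa [par_eq hw hu h, ← g_old u hu] at this
  have dist_eq {v : V} (hv : T.dist x v ≤ n + 1) : T.dist y (g v) = T.dist x v := by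
    rcases cases_dist hv with h | h
    · rw [g_old v h, hf.dist_map v h]
    · rw [g_dist h, h]
  refine ⟨g, ⟨?_, fun v hv => dist_eq hv, fun v hv => ?_, fun u w hu hw h => ?_,
    fun u w hu hw h => ?_, fun v hv => ?_⟩⟩
  · rw [g_old x (by simp), hf.map_center]
  · rcases cases_dist hv with h | h
    · rw [g_old v h]
      exact hf.refineEquiv v h
    · rw [g_new v h, h]
      exact (hσ _ (hpar v h).2).2.1 v (hpar v h).1
  · rcases cases_dist hu with hu | hu <;> rcases cases_dist hw with hw | hw
    · rw [g_old u hu, g_old w hw]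
      exact hf.map_adj u w hu hw h
    · exact adj_aux hu hw h
    · exact (adj_aux hw hu h.symm).symm
    · exact absurd (hu.trans hw.symm) (hT.dist_ne_of_adj x h)
  · have hd : T.dist x u = T.dist x w := by rw [← dist_eq hu, ← dist_eq hw, h]
    rcases cases_dist hu with hu | hu
    · rw [g_old u hu, g_old w (by omega)] at h
      exact hf.injOn u w hu (by omega) h
    · have hw : T.dist x w = n + 1 := by omega
      have hp : f (par u) = f (par w) := by
        refine hT.eq_of_adj_of_dist_le (x := y) (g_adj hu) (h ▸ g_adj hw) ?_ ?_
        · rw [hf.dist_map _ (hpar u hu).2.le, g_dist hu, (hpar u hu).2]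
          omega
        · rw [hf.dist_map _ (hpar w hw).2.le, g_dist hu, (hpar w hw).2]
          omega
      have hp := hf.injOn _ _ (hpar u hu).2.le (hpar w hw).2.le hp
      rw [g_new u hu, g_new w hw, ← hp] at h
      exact (hσ _ (hpar u hu).2).2.2.2.1 u w (hpar u hu).1 (hp ▸ (hpar w hw).1) h
  · by_cases hvn : T.dist y v ≤ n
    · obtain ⟨u, hu, rfl⟩ := hf.surjOn v hvn
      exact ⟨u, by omega, g_old u hu⟩
    · obtain ⟨q, hq, hqd⟩ := hT.exists_adj_dist_add_one (x := y) (v := v) (by omega)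
      obtain ⟨u, hu, rfl⟩ := hf.surjOn q (by omega)
      have hun : T.dist x u = n := by rw [← hf.dist_map u hu]; omega
      obtain ⟨-, -, h3, -, h5⟩ := hσ u hun
      obtain ⟨w, hw, rfl⟩ := h5 v hq
      have hs := hT.dist_eq_dist_add_one_of_adj x hw
      have hwn : ¬ T.dist x w ≤ n := fun hwn => by
        rw [h3 w hw hwn, hf.dist_map w hwn] at hvn
        exact hvn hwn
      have hw1 : T.dist x w = n + 1 := by omega
      exact ⟨w, hw1.le, by rw [g_new w hw1, par_eq hw1 hu hw]⟩

theorem ballEquiv (hT : T.IsTree) (hf : IsPartialBallIso T φ N n x y f) : BallEquiv T φ n x y := by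
  have key {u w : V} (hu : T.dist x u ≤ n) (hw : T.dist x w ≤ n) (h : T.Adj (f u) (f w))
      (hd : T.dist x u ≤ T.dist x w) : T.Adj u w := by
    have hdu := hf.dist_map u hu
    have hdw := hf.dist_map w hw
    have hs := hT.dist_eq_dist_add_one_of_adj y h
    obtain ⟨p, hp, hpd⟩ := hT.exists_adj_dist_add_one (x := x) (v := w) (by omega)
    have hdp := hf.dist_map p (by omega)
    have : f p = f u := hT.eq_of_adj_of_dist_le (x := y)
      (hf.map_adj p w (by omega) hw hp) h (by omega) (by omega)
    exact hf.injOn p u (by omega) hu this ▸ hp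
  let F (u : {v : V // T.dist x v ≤ n}) : {v : V // T.dist y v ≤ n} :=
    ⟨f u, (hf.dist_map u u.2).trans_le u.2⟩
  have hF : Function.Bijective F := by
    refine ⟨fun u w h => Subtype.ext (hf.injOn u w u.2 w.2 (congrArg Subtype.val h)), fun v => ?_⟩
    obtain ⟨u, hu, h⟩ := hf.surjOn v v.2
    exact ⟨⟨u, hu⟩, Subtype.ext h⟩
  refine ⟨Equiv.ofBijective F hF, hf.map_center, fun u w => ⟨hf.map_adj u w u.2 w.2, fun h => ?_⟩,
    fun v => (hf.refineEquiv v v.2).color_eq.symm⟩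
  rcases le_total (T.dist x u) (T.dist x w) with hd | hd
  · exact key u.2 w.2 h hd
  · exact (key w.2 u.2 h.symm hd).symm

end IsPartialBallIso

theorem RefineEquiv.ballEquiv {V A : Type*} {T : SimpleGraph V} {φ : V → A} (hT : T.IsTree)
    {n : ℕ} {x y : V} (h : RefineEquiv T φ n x y) : BallEquiv T φ n x y := by
  have key : ∀ j ≤ n, ∃ f, IsPartialBallIso T φ n j x y f := by
    intro j
    induction j with
    | zero =>
      have h0 {u v : V} (huv : T.dist u v ≤ 0) : v = u :=
        (hT.connected.dist_eq_zero_iff.1 (Nat.le_zero.1 huv)).symm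
      refine fun _ => ⟨fun _ => y, rfl, fun u hu => ?_, fun u hu => ?_, fun u w hu hw huw => ?_,
        fun u w hu hw _ => ?_, fun v hv => ?_⟩
      · simp [h0 hu]
      · rw [h0 hu]
        simpa using h
      · rw [h0 hu, h0 hw] at huw
        exact absurd huw (T.irrefl)
      · rw [h0 hu, h0 hw]
      · exact ⟨x, by simp, (h0 hv).symm⟩
    | succ j ih =>
      intro hj
      obtain ⟨f, hf⟩ := ih (by omega)
      exact hf.exists_succ hT hj
  obtain ⟨f, hf⟩ := key n le_rfl
  exact hf.ballEquiv hT

theorem ballEquiv_iff_refineEquiv {V A : Type*} {T : SimpleGraph V} {φ : V → A} {k : ℕ}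
    (hT : T.IsTree) (hk : k ≠ 0) (hreg : ∀ v : V, (T.neighborSet v).ncard = k) {n : ℕ} {x y : V} :
    BallEquiv T φ n x y ↔ RefineEquiv T φ n x y :=
  ⟨fun h => h.refineEquiv hT hk hreg, fun h => h.ballEquiv hT⟩

theorem Function.Surjective.eq_or_eq_of_card_eq_succ {α β : Type*} [Finite α] {π : α → β}
    (hπ : Function.Surjective π) (hcard : Nat.card α = Nat.card β + 1) {a a' b b' : α}
    (ha : a ≠ a') (haπ : π a = π a') (hb : b ≠ b') (hbπ : π b = π b') : a' = b ∨ a' = b' := by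
  classical
  by_contra! h
  have := Finite.of_surjective π hπ
  have hsurj : Function.Surjective fun c : {c // c ≠ a'} => π c := fun q => by
    obtain ⟨c, rfl⟩ := hπ q
    by_cases hc : c = a'
    · exact ⟨⟨a, ha⟩, by rw [hc, ← haπ]⟩
    · exact ⟨⟨c, hc⟩, rfl⟩
  have hc : Nat.card {c // c ≠ a'} = Nat.card β := by
    have := Fintype.ofFinite α
    rw [Nat.card_eq_fintype_card, Fintype.card_subtype_compl, Fintype.card_subtype_eq,
      ← Nat.card_eq_fintype_card, hcard, Nat.add_sub_cancel]
  have hinj := ((Nat.bijective_iff_surjective_and_card _).2 ⟨hsurj, hc⟩).1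
  have := @hinj ⟨b, h.1.symm⟩ ⟨b', h.2.symm⟩ hbπ
  exact hb (congrArg Subtype.val this)

section Refinement

variable {V A : Type*} {T : SimpleGraph V} {φ : V → A}

theorem RefineEquiv.exists_adj {n : ℕ} {x y w : V} (h : RefineEquiv T φ (n + 1) x y)
    (hw : T.Adj x w) : ∃ w', T.Adj y w' ∧ RefineEquiv T φ n w w' := by
  obtain ⟨-, σ, hσ⟩ := h
  exact ⟨σ ⟨w, hw⟩, (σ ⟨w, hw⟩).2, hσ ⟨w, hw⟩⟩

theorem RefineEquiv.quot_mk_eq_iff {n : ℕ} {x y : V} :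
    Quot.mk (RefineEquiv T φ n) x = Quot.mk (RefineEquiv T φ n) y ↔ RefineEquiv T φ n x y := by
  have heq : Equivalence (RefineEquiv T φ n) :=
    ⟨RefineEquiv.refl n, RefineEquiv.symm, RefineEquiv.trans⟩
  rw [Quot.eq, heq.eqvGen_iff]

/-- The `n`-th refinement class of `x` is divided by the next refinement step. -/
def Splits (T : SimpleGraph V) (φ : V → A) (n : ℕ) (x : V) : Prop :=
  ∃ y, RefineEquiv T φ n x y ∧ ¬ RefineEquiv T φ (n + 1) x y

theorem RefineEquiv.succ_of_not_splits {n : ℕ} {x y : V} (h : RefineEquiv T φ n x y)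
    (hx : ¬ Splits T φ n x) : RefineEquiv T φ (n + 1) x y :=
  by_contra fun hn => hx ⟨y, h, hn⟩

theorem Splits.congr {n : ℕ} {x y : V} (hx : Splits T φ n x) (h : RefineEquiv T φ n x y) :
    Splits T φ n y := by
  by_contra hy
  obtain ⟨z, hz, hz'⟩ := hx
  exact hz' ((h.symm.succ_of_not_splits hy).symm.trans
    ((h.symm.trans hz).succ_of_not_splits hy))

theorem Splits.exists_adj {n : ℕ} {x : V} (hx : Splits T φ (n + 1) x) :
    ∃ w, T.Adj x w ∧ Splits T φ n w := by
  by_contra! h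
  obtain ⟨y, ⟨hc, σ, hσ⟩, hxy⟩ := hx
  exact hxy ⟨hc, σ, fun w => (hσ w).succ_of_not_splits (h w w.2)⟩

theorem isSpecial_iff_splits {k : ℕ} (hT : T.IsTree) (hk : k ≠ 0)
    (hreg : ∀ v : V, (T.neighborSet v).ncard = k) {n : ℕ} {x : V} :
    IsSpecial T φ n x ↔ Splits T φ n x := by
  simp only [IsSpecial, ballEquiv_iff_refineEquiv hT hk hreg]
  constructor
  · rintro ⟨y, z, hy, hz, hyz⟩
    by_contra hx
    exact hyz ((hy.succ_of_not_splits hx).symm.trans (hz.succ_of_not_splits hx))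
  · rintro ⟨y, hy, hxy⟩
    exact ⟨x, y, .refl n x, hy, hxy⟩

/-- Linear growth of the number of refinement classes: each step adds one class. -/
def LinearGrowth (T : SimpleGraph V) (φ : V → A) : Prop :=
  ∀ n, Nat.card (Quot (RefineEquiv T φ n)) = n + 2

theorem IsSturmian.linearGrowth {k : ℕ} (hT : T.IsTree) (hk : k ≠ 0)
    (hreg : ∀ v : V, (T.neighborSet v).ncard = k) (h : IsSturmian T φ) : LinearGrowth T φ := by
  intro n
  have : BallEquiv T φ n = RefineEquiv T φ n := by
    ext x y
    exact ballEquiv_iff_refineEquiv hT hk hreg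
  rw [← this]
  exact h n

namespace LinearGrowth

theorem finite_quot (h : LinearGrowth T φ) (n : ℕ) : Finite (Quot (RefineEquiv T φ n)) :=
  Nat.finite_of_card_ne_zero (by rw [h n]; omega)

theorem infinite (h : LinearGrowth T φ) : Infinite V := by
  by_contra hV
  have := not_infinite_iff_finite.1 hV
  have := Nat.card_le_card_of_surjective (Quot.mk (RefineEquiv T φ (Nat.card V)))
    Quot.mk_surjective
  rw [h] at this
  omega

theorem or_of_not_succ (h : LinearGrowth T φ) {n : ℕ} {x y z w : V}
    (hxy : RefineEquiv T φ n x y) (hxy' : ¬ RefineEquiv T φ (n + 1) x y)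
    (hzw : RefineEquiv T φ n z w) (hzw' : ¬ RefineEquiv T φ (n + 1) z w) :
    RefineEquiv T φ (n + 1) y z ∨ RefineEquiv T φ (n + 1) y w := by
  have := h.finite_quot (n + 1)
  simp only [← RefineEquiv.quot_mk_eq_iff (n := n + 1)] at hxy' hzw' ⊢
  let π : Quot (RefineEquiv T φ (n + 1)) → Quot (RefineEquiv T φ n) :=
    Quot.map id fun _ _ => RefineEquiv.of_succ
  have hπ : Function.Surjective π := fun q => by
    obtain ⟨v, rfl⟩ := Quot.mk_surjective q
    exact ⟨Quot.mk _ v, rfl⟩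
  exact hπ.eq_or_eq_of_card_eq_succ (by rw [h, h]) hxy' (RefineEquiv.quot_mk_eq_iff.2 hxy) hzw'
    (RefineEquiv.quot_mk_eq_iff.2 hzw)

theorem refineEquiv_of_splits (h : LinearGrowth T φ) {n : ℕ} {x y : V} (hx : Splits T φ n x)
    (hy : Splits T φ n y) : RefineEquiv T φ n x y := by
  obtain ⟨x', hx, hx'⟩ := hx
  obtain ⟨y', hy, hy'⟩ := hy
  rcases h.or_of_not_succ hx hx' hy hy' with h | h
  · exact hx.trans h.of_succ
  · exact hx.trans (h.of_succ.trans hy.symm)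

theorem or_of_splits (h : LinearGrowth T φ) {n : ℕ} {x y z : V} (hxy : RefineEquiv T φ n x y)
    (hxy' : ¬ RefineEquiv T φ (n + 1) x y) (hz : Splits T φ n z) :
    RefineEquiv T φ (n + 1) x z ∨ RefineEquiv T φ (n + 1) y z := by
  obtain ⟨w, hzw, hzw'⟩ := hz
  rcases h.or_of_not_succ hxy hxy' hzw hzw' with h1 | h1
  · exact .inr h1
  rcases h.or_of_not_succ hxy.symm (fun h => hxy' h.symm) hzw hzw' with h2 | h2
  · exact .inl h2
  exact absurd (h2.trans h1.symm) hxy'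

theorem exists_splits (h : LinearGrowth T φ) (n : ℕ) : ∃ x, Splits T φ n x := by
  by_contra! hn
  have := h.finite_quot n
  let π : Quot (RefineEquiv T φ n) → Quot (RefineEquiv T φ (n + 1)) :=
    Quot.map id fun _ _ hxy => hxy.succ_of_not_splits (hn _)
  have hπ : Function.Surjective π := fun q => by
    obtain ⟨v, rfl⟩ := Quot.mk_surjective q
    exact ⟨Quot.mk _ v, rfl⟩
  have := Nat.card_le_card_of_surjective π hπ
  rw [h, h] at this
  omega

/-- There are only two initial classes. -/
theorem zero_or (h : LinearGrowth T φ) {x y z : V} (hxy : ¬ RefineEquiv T φ 0 x y) :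
    RefineEquiv T φ 0 x z ∨ RefineEquiv T φ 0 y z := by
  by_contra! hz
  simp only [← RefineEquiv.quot_mk_eq_iff (n := 0)] at hxy hz
  have := h.finite_quot 0
  have hinj : Function.Injective ![Quot.mk (RefineEquiv T φ 0) x, Quot.mk (RefineEquiv T φ 0) y,
      Quot.mk (RefineEquiv T φ 0) z] := by
    intro i j hij
    fin_cases i <;> fin_cases j <;> simp_all [eq_comm]
  have := Nat.card_le_card_of_injective _ hinj
  rw [h] at this
  simp at this

end LinearGrowth

/-- `b x` is the first step from which on the refinement class of `x` never splits again. -/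
structure IsBirthTime (T : SimpleGraph V) (φ : V → A) (b : V → ℕ) : Prop where
  not_splits : ∀ x n, b x ≤ n → ¬ Splits T φ n x
  splits : ∀ x n, b x = n + 1 → Splits T φ n x

namespace IsBirthTime

variable {b : V → ℕ}

theorem refineEquiv (hb : IsBirthTime T φ b) {x y : V} (h : RefineEquiv T φ (b x) x y) (n : ℕ) :
    RefineEquiv T φ n x y := by
  rcases le_total n (b x) with hn | hn
  · exact h.mono hn
  · induction n, hn using Nat.le_induction with
    | base => exact h
    | succ n hn ih => exact ih.succ_of_not_splits (hb.not_splits x n hn)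

theorem le_of_refineEquiv (hb : IsBirthTime T φ b) {x y : V} (h : RefineEquiv T φ (b x) x y) :
    b y ≤ b x := by
  by_contra! hlt
  refine hb.not_splits x (b y - 1) (by omega) ?_
  exact (hb.splits y (b y - 1) (by omega)).congr (hb.refineEquiv h _).symm

theorem eq_of_refineEquiv (hb : IsBirthTime T φ b) {x y : V} (h : RefineEquiv T φ (b x) x y) :
    b y = b x :=
  le_antisymm (hb.le_of_refineEquiv h) (hb.le_of_refineEquiv (hb.refineEquiv h _).symm)

theorem finite_class_of_adj (hb : IsBirthTime T φ b) (hfin : ∀ v, (T.neighborSet v).Finite)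
    {x y : V} (hxy : T.Adj x y) (hx : {z | RefineEquiv T φ (b x) x z}.Finite) :
    {z | RefineEquiv T φ (b y) y z}.Finite := by
  refine (hx.biUnion fun w _ => hfin w).subset fun z hz => ?_
  obtain ⟨w, hzw, hw⟩ := (hb.refineEquiv hz (b x + 1)).exists_adj hxy.symm
  exact Set.mem_biUnion (x := w) hw hzw.symm

theorem finite_class_of_exists (hb : IsBirthTime T φ b) (hT : T.Connected)
    (hfin : ∀ v, (T.neighborSet v).Finite)
    (hex : ∃ x, {z | RefineEquiv T φ (b x) x z}.Finite) (y : V) :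
    {z | RefineEquiv T φ (b y) y z}.Finite := by
  obtain ⟨x, hx⟩ := hex
  obtain ⟨p⟩ := hT.preconnected x y
  induction p with
  | nil => exact hx
  | cons h _ ih => exact ih (hb.finite_class_of_adj hfin h hx)

theorem _root_.LinearGrowth.infinite_splits (hg : LinearGrowth T φ)
    (hfin : ∀ v, (T.neighborSet v).Finite)
    (hcl : ∀ x, {z | RefineEquiv T φ (b x) x z}.Finite) (n : ℕ) :
    {x | Splits T φ n x}.Infinite := by
  intro hn
  have hN : ∀ N ≥ n, {x | Splits T φ N x}.Finite := fun N hN => by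
    induction N, hN using Nat.le_induction with
    | base => exact hn
    | succ N _ ih =>
      refine (ih.biUnion fun w _ => hfin w).subset fun z hz => ?_
      obtain ⟨w, hzw, hw⟩ := Splits.exists_adj hz
      exact Set.mem_biUnion (x := w) hw hzw.symm
  have := hg.infinite
  have := hg.finite_quot n
  obtain ⟨q, hq⟩ := Finite.exists_infinite_fiber (Quot.mk (RefineEquiv T φ n))
  obtain ⟨x, rfl⟩ := Quot.mk_surjective q
  have hx : {y | RefineEquiv T φ n x y}.Infinite := by
    refine (Set.infinite_coe_iff.1 hq).mono fun y hy => ?_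
    exact (RefineEquiv.quot_mk_eq_iff.1 hy).symm
  have key : ∀ N ≥ n, {y | RefineEquiv T φ N x y}.Infinite := fun N hNn => by
    induction N, hNn using Nat.le_induction with
    | base => exact hx
    | succ N hNn ih =>
      have hs : ¬ Splits T φ N x := fun hs => ih ((hN N hNn).subset fun y hy => hs.congr hy)
      exact ih.mono fun y hy => RefineEquiv.succ_of_not_splits hy hs
  refine key (max n (b x)) (le_max_left _ _) ((hcl x).subset fun y hy => ?_)
  exact RefineEquiv.mono (le_max_right _ _) hy

section FiniteClasses

variable (hb : IsBirthTime T φ b) (hg : LinearGrowth T φ) (hfin : ∀ v, (T.neighborSet v).Finite)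
  (hcl : ∀ x, {z | RefineEquiv T φ (b x) x z}.Finite)
include hb hg hfin hcl

theorem le_add_one_of_adj {x y : V} (hxy : T.Adj x y) : b y ≤ b x + 1 := by
  by_contra! hlt
  obtain ⟨N, hN⟩ : ∃ N, b y = N + 2 := ⟨b y - 2, by omega⟩
  refine hg.infinite_splits hfin hcl (N + 1)
    (((hcl x).biUnion fun w _ => hfin w).subset fun z hz => ?_)
  obtain ⟨w, hzw, hw⟩ := (hg.refineEquiv_of_splits (hb.splits y (N + 1) hN) hz).exists_adj hxy.symm
  exact Set.mem_biUnion (x := w) (hw.mono (by omega)) hzw.symm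

theorem refineEquiv_of_eq {x y : V} (hxy : b x = b y) : RefineEquiv T φ (b x) x y := by
  by_contra hn
  rcases hbx : b x with _ | j
  · rw [hbx] at hn
    obtain ⟨z, hz⟩ := hg.exists_splits 0
    rcases hg.zero_or (z := z) hn with h | h
    · exact hb.not_splits x 0 hbx.le (hz.congr h.symm)
    · exact hb.not_splits y 0 (hxy ▸ hbx.le) (hz.congr h.symm)
  · have hx := hb.splits x j hbx
    have hy := hb.splits y j (hxy ▸ hbx)
    refine hg.infinite_splits hfin hcl j (((hcl x).union (hcl y)).subset fun z hz => ?_)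
    rw [hbx] at hn
    rcases hg.or_of_splits (hg.refineEquiv_of_splits hx hy) hn hz with h | h
    · exact .inl (by rwa [← hbx] at h)
    · exact .inr (by rwa [← hbx, hxy] at h)

theorem finite_le (i : ℕ) : {x | b x ≤ i}.Finite := by
  have hlev : ∀ j, {x | b x = j}.Finite := fun j => by
    rcases Set.eq_empty_or_nonempty {x | b x = j} with h | ⟨x, hx⟩
    · rw [h]
      exact Set.finite_empty
    · refine (hcl x).subset fun y hy => hb.refineEquiv_of_eq hg hfin hcl ?_
      exact hx.trans hy.symm
  refine ((Set.finite_Iic i).biUnion fun j _ => hlev j).subset fun x hx => ?_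
  exact Set.mem_biUnion (x := b x) hx rfl

theorem exists_equiv_neighborSet {x y : V} (hxy : b x = b y) :
    ∃ σ : T.neighborSet x ≃ T.neighborSet y, ∀ w, b (σ w) = b w := by
  obtain ⟨-, σ, hσ⟩ := hb.refineEquiv (hb.refineEquiv_of_eq hg hfin hcl hxy) (b x + 2)
  refine ⟨σ, fun w => hb.eq_of_refineEquiv ((hσ w).mono ?_)⟩
  exact hb.le_add_one_of_adj hg hfin hcl w.2

theorem exists_adj_add_one (hT : T.Connected) {x y : V} (hxy : b y < b x) :
    ∃ w, T.Adj x w ∧ b w + 1 = b x := by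
  suffices h : ∃ u w, T.Adj u w ∧ b u = b x ∧ b w + 1 = b x by
    obtain ⟨u, w, huw, hu, hw⟩ := h
    obtain ⟨σ, hσ⟩ := hb.exists_equiv_neighborSet hg hfin hcl hu
    exact ⟨σ ⟨w, huw⟩, (σ ⟨w, huw⟩).2, by rw [hσ]; exact hw⟩
  have key : ∀ i (u v : V), T.Walk u v → i ≤ b u → b v < i →
      ∃ u w, T.Adj u w ∧ b u = i ∧ b w + 1 = i := by
    intro i u v p
    induction p with
    | nil => omega
    | @cons u w v h _ ih =>
      intro hu hv
      by_cases hw : i ≤ b w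
      · exact ih hw hv
      · have := hb.le_add_one_of_adj hg hfin hcl h.symm
        exact ⟨u, w, h, by omega, by omega⟩
  obtain ⟨p⟩ := hT.preconnected x y
  exact key (b x) x y p le_rfl hxy

theorem eq_of_adj_of_le (hT : T.IsTree) {k : ℕ} (hk : 2 ≤ k)
    (hreg : ∀ v : V, (T.neighborSet v).ncard = k) {x w w' : V} (hw : T.Adj x w)
    (hw' : T.Adj x w') (hbw : b w ≤ b x) (hbw' : b w' ≤ b x) : w = w' := by
  obtain ⟨z, hz, hmax⟩ := Set.exists_max_image {z | b z ≤ b x} (T.dist x)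
    (hb.finite_le hg hfin hcl (b x)) ⟨x, le_refl (b x)⟩
  have hz1 : ∀ u u', T.Adj z u → T.Adj z u' → b u ≤ b x → b u' ≤ b x → u = u' :=
    fun u u' hu hu' hbu hbu' =>
      hT.eq_of_adj_of_dist_le hu.symm hu'.symm (hmax u hbu) (hmax u' hbu')
  rcases (show b z ≤ b x from hz).lt_or_eq with hlt | heq
  · exfalso
    obtain ⟨u, hu, u', hu', hne⟩ := (Set.one_lt_ncard (hfin z)).1 (by rw [hreg]; exact hk)
    have h1 := hb.le_add_one_of_adj hg hfin hcl (y := u) hu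
    have h2 := hb.le_add_one_of_adj hg hfin hcl (y := u') hu'
    exact hne (hz1 u u' hu hu' (by omega) (by omega))
  · obtain ⟨σ, hσ⟩ := hb.exists_equiv_neighborSet hg hfin hcl heq.symm
    have := hz1 _ _ (σ ⟨w, hw⟩).2 (σ ⟨w', hw'⟩).2 ((hσ _).trans_le hbw) ((hσ _).trans_le hbw')
    exact congrArg Subtype.val (σ.injective (Subtype.ext this))

end FiniteClasses

end IsBirthTime

/-- The vertices at distance greater than `n` from `K`. -/
def FarFrom (T : SimpleGraph V) (K : Set V) : ℕ → V → Prop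
  | 0, x => x ∉ K
  | n + 1, x => x ∉ K ∧ ∀ w, T.Adj x w → FarFrom T K n w

theorem FarFrom.notMem {K : Set V} {n : ℕ} {x : V} (h : FarFrom T K n x) : x ∉ K := by
  cases n with
  | zero => exact h
  | succ n => exact h.1

theorem finite_not_farFrom (hfin : ∀ v, (T.neighborSet v).Finite) {K : Set V} (hK : K.Finite)
    (n : ℕ) : {x | ¬ FarFrom T K n x}.Finite := by
  induction n with
  | zero => simpa [FarFrom] using hK
  | succ n ih =>
    refine (hK.union (ih.biUnion fun w _ => hfin w)).subset fun x hx => ?_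
    by_cases hxK : x ∈ K
    · exact .inl hxK
    · have : ∃ w, T.Adj x w ∧ ¬ FarFrom T K n w := by
        by_contra! h
        exact hx ⟨hxK, h⟩
      obtain ⟨w, hxw, hw⟩ := this
      exact .inr (Set.mem_biUnion (x := w) hw hxw.symm)

theorem exists_adj_reachable_induce_compl (hT : T.Connected) {K : Set V} (hK : K.Nonempty) {x : V}
    (hx : x ∉ K) : ∃ z ∈ K, ∃ u : (Kᶜ : Set V), T.Adj z u ∧
      (T.induce (Kᶜ : Set V)).Reachable u ⟨x, hx⟩ := by
  obtain ⟨z, hz⟩ := hK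
  obtain ⟨p⟩ := hT.preconnected x z
  induction p with
  | nil => exact absurd hz hx
  | @cons x y z h _ ih =>
    by_cases hy : y ∈ K
    · exact ⟨y, hy, ⟨x, hx⟩, h.symm, .refl _⟩
    · obtain ⟨z', hz', u, hu, hr⟩ := ih hy hz
      refine ⟨z', hz', u, hu, hr.trans (Adj.reachable ?_)⟩
      exact h.symm

/-- A color-preserving symmetry of a coloring that agrees with `φ` on one component of the
complement of `K` matches the refinement classes of far away vertices of this component. -/
theorem refineEquiv_of_farFrom {K : Set V} {ψ : V → A} {u : (Kᶜ : Set V)}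
    (hψ : ∀ w : (Kᶜ : Set V), (T.induce (Kᶜ : Set V)).Reachable u w → ψ w = φ w)
    {γ : Equiv.Perm V} (hadj : ∀ v w, T.Adj (γ v) (γ w) ↔ T.Adj v w) (hcol : ∀ v, ψ (γ v) = ψ v)
    {n : ℕ} {x : V} (hx : FarFrom T K n x) (hγx : FarFrom T K n (γ x))
    (hr : (T.induce (Kᶜ : Set V)).Reachable u ⟨x, hx.notMem⟩)
    (hγr : (T.induce (Kᶜ : Set V)).Reachable u ⟨γ x, hγx.notMem⟩) :
    RefineEquiv T φ n x (γ x) := by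
  have hc {x : V} (hx : x ∉ K) (hγx : γ x ∉ K)
      (hr : (T.induce (Kᶜ : Set V)).Reachable u ⟨x, hx⟩)
      (hγr : (T.induce (Kᶜ : Set V)).Reachable u ⟨γ x, hγx⟩) : φ x = φ (γ x) := by
    rw [← hψ _ hr, ← hψ _ hγr, hcol]
  induction n generalizing x with
  | zero => exact hc hx hγx hr hγr
  | succ n ih =>
    refine ⟨hc hx.1 hγx.1 hr hγr, γ.subtypeEquiv fun w => (hadj x w).symm, fun w => ?_⟩
    have hw := hx.2 w w.2
    have hγw := hγx.2 (γ w) ((hadj x w).2 w.2)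
    refine ih hw hγw (hr.trans (Adj.reachable ?_)) (hγr.trans (Adj.reachable ?_))
    · exact w.2
    · exact (hadj x w).2 w.2

theorem IsEventuallyPeriodic.exists_finite_invariant (h : IsEventuallyPeriodic T φ)
    (hT : T.Connected) (hfin : ∀ v, (T.neighborSet v).Finite) :
    ∃ K : Set V, K.Finite ∧ ∃ (N : ℕ) (c : V → Fin N), ∀ n x y,
      FarFrom T K n x → FarFrom T K n y → c x = c y → RefineEquiv T φ n x y := by
  obtain ⟨K, hKne, hK, -, hper⟩ := h
  choose ψ hψper hψ using hper
  choose Γ hadj hcol horb using hψper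
  let bd : Set (Kᶜ : Set V) := {u | ∃ z ∈ K, T.Adj z u}
  have hbd : bd.Finite := by
    refine Set.Finite.of_finite_image (f := Subtype.val) ?_ Subtype.val_injective.injOn
    refine (hK.biUnion fun z _ => hfin z).subset ?_
    rintro _ ⟨u, ⟨z, hz, hzu⟩, rfl⟩
    exact Set.mem_biUnion hz hzu
  have := hbd.to_subtype
  let orb (u : (Kᶜ : Set V)) : V → V → Prop := fun x y => ∃ γ ∈ Γ u, γ x = y
  have horb' (u : (Kᶜ : Set V)) : Equivalence (orb u) :=
    ⟨fun x => ⟨1, (Γ u).one_mem, rfl⟩,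
      fun {x y} ⟨γ, hγ, h⟩ => ⟨γ⁻¹, (Γ u).inv_mem hγ, by rw [← h]; simp⟩,
      fun {x y z} ⟨γ, hγ, h⟩ ⟨γ', hγ', h'⟩ => ⟨γ' * γ, (Γ u).mul_mem hγ' hγ, by
        rw [← h', ← h]; rfl⟩⟩
  have (u : bd) : Finite (Quot (orb u)) := horb u
  have hex : ∀ x : V, ∃ u : Option bd, ∀ hx : x ∉ K, ∃ v, u = some v ∧
      (T.induce (Kᶜ : Set V)).Reachable (v : (Kᶜ : Set V)) ⟨x, hx⟩ := fun x => by
    by_cases hx : x ∈ K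
    · exact ⟨none, fun h => absurd hx h⟩
    · obtain ⟨z, hz, u, hzu, hu⟩ := exists_adj_reachable_induce_compl hT hKne hx
      exact ⟨some ⟨u, z, hz, hzu⟩, fun _ => ⟨_, rfl, hu⟩⟩
  choose base hbase using hex
  obtain ⟨N, ⟨e⟩⟩ := Finite.exists_equiv_fin (Option (Σ u : bd, Quot (orb u)))
  refine ⟨K, hK, N, fun x => e ((base x).map fun u => ⟨u, Quot.mk _ x⟩),
    fun n x y hx hy hxy => ?_⟩
  obtain ⟨u, hu, hur⟩ := hbase x hx.notMem
  obtain ⟨v, hv, hvr⟩ := hbase y hy.notMem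
  simp only [hu, hv, Option.map_some, e.apply_eq_iff_eq, Option.some.injEq,
    Sigma.mk.injEq] at hxy
  obtain ⟨rfl, hxy⟩ := hxy
  rw [heq_iff_eq, Quot.eq, (horb' u).eqvGen_iff] at hxy
  obtain ⟨γ, hγ, rfl⟩ := hxy
  exact refineEquiv_of_farFrom (hψ u) (hadj u γ hγ) (hcol u γ hγ) hx hy hur hvr

theorem IsBirthTime.finite_class {b : V → ℕ} (hb : IsBirthTime T φ b) (hg : LinearGrowth T φ)
    (hT : T.Connected) (hfin : ∀ v, (T.neighborSet v).Finite) (hep : IsEventuallyPeriodic T φ)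
    (x : V) : {z | RefineEquiv T φ (b x) x z}.Finite := by
  refine hb.finite_class_of_exists hT hfin ?_ x
  by_contra! hinf
  obtain ⟨K, hK, N, c, hc⟩ := hep.exists_finite_invariant hT hfin
  have hfar (n : ℕ) (x : V) : ∃ y, RefineEquiv T φ n x y ∧ FarFrom T K n y := by
    have hx : {z | RefineEquiv T φ n x z}.Infinite :=
      (hinf x).mono fun z hz => hb.refineEquiv hz n
    obtain ⟨y, hy, hy'⟩ := hx.exists_notMem_finite (finite_not_farFrom hfin hK n)
    exact ⟨y, hy, not_not.1 hy'⟩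
  choose r hr hrfar using hfar
  have hinj : Function.Injective fun q : Quot (RefineEquiv T φ N) => c (r N q.out) := by
    intro q q' hqq
    have h := hc N _ _ (hrfar N q.out) (hrfar N q'.out) hqq
    rw [← Quot.out_eq q, ← Quot.out_eq q']
    exact RefineEquiv.quot_mk_eq_iff.2 ((hr N _).trans (h.trans (hr N _).symm))
  have := Nat.card_le_card_of_injective _ hinj
  rw [hg, Nat.card_fin] at this
  omega

end Refinement

theorem Set.Finite.exists_sSup_insert_neg_one {S : Set ℕ} (hS : S.Finite) :
    ∃ b : ℕ, sSup (insert (-1) ((fun n : ℕ => (n : ℤ)) '' S)) = (b : ℤ) - 1 ∧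
      (∀ n, b ≤ n → n ∉ S) ∧ ∀ n, b = n + 1 → n ∈ S := by
  rcases S.eq_empty_or_nonempty with rfl | hne
  · exact ⟨0, by simp⟩
  · obtain ⟨a, ha, hmax⟩ := Set.exists_max_image S id hS hne
    refine ⟨a + 1, ?_, fun n hn hnS => ?_, fun n hn => ?_⟩
    · refine IsGreatest.csSup_eq ⟨.inr ⟨a, ha, by simp⟩, ?_⟩
      rintro _ (rfl | ⟨n, hn, rfl⟩)
      · push_cast
        omega
      · have : n ≤ a := hmax n hn
        push_cast
        omega
    · have : n ≤ a := hmax n hnS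
      omega
    · rwa [← Nat.succ_injective hn]

theorem exists_isBirthTime {V A : Type*} {T : SimpleGraph V} {φ : V → A} {k : ℕ}
    (hT : T.IsTree) (hk : k ≠ 0) (hreg : ∀ v : V, (T.neighborSet v).ncard = k)
    (hbd : ∀ v : V, (TypeSet T φ v).Finite) :
    ∃ b : V → ℕ, IsBirthTime T φ b ∧ ∀ x, maxType T φ x = (b x : ℤ) - 1 := by
  choose b h1 h2 h3 using fun v => (hbd v).exists_sSup_insert_neg_one
  have hsp {n : ℕ} {x : V} : n ∈ TypeSet T φ x ↔ Splits T φ n x := isSpecial_iff_splits hT hk hreg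
  exact ⟨b, ⟨fun x n hn h => h2 x n hn (hsp.2 h), fun x n hn => hsp.1 (h3 x n hn)⟩, h1⟩

theorem stmt_16 {V A : Type*} (T : SimpleGraph V) (φ : V → A) (k : ℕ)
    (hk : 2 ≤ k) (htree : T.IsTree) (hreg : ∀ v : V, (T.neighborSet v).ncard = k)
    (hst : IsSturmian T φ) (hep : IsEventuallyPeriodic T φ)
    (hbd : ∀ v : V, (TypeSet T φ v).Finite)
    (m : ℤ) (hm : IsLeast (Set.range (maxType T φ)) m) :
    (∀ x : V, m < maxType T φ x →
      {y : V | T.Adj x y ∧ maxType T φ y = maxType T φ x - 1}.ncard = 1 ∧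
      {y : V | T.Adj x y ∧ maxType T φ y = maxType T φ x + 1}.ncard = k - 1 ∧
      ¬ ∃ y : V, T.Adj x y ∧ maxType T φ y = maxType T φ x) ∧
    (∀ x : V, maxType T φ x = m →
      {y : V | T.Adj x y ∧ maxType T φ y = m}.ncard ≤ 1 ∧
      (∀ y : V, T.Adj x y → maxType T φ y = m ∨ maxType T φ y = m + 1) ∧
      ((∀ y : V, T.Adj x y → maxType T φ y = m + 1) ∨
        ({y : V | T.Adj x y ∧ maxType T φ y = m}.ncard = 1 ∧
         {y : V | T.Adj x y ∧ maxType T φ y = m + 1}.ncard = k - 1))) := by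
  have hk0 : k ≠ 0 := by omega
  have hfin (v : V) : (T.neighborSet v).Finite :=
    Set.finite_of_ncard_ne_zero (by rw [hreg]; exact hk0)
  have hg := hst.linearGrowth htree hk0 hreg
  obtain ⟨b, hb, hτ⟩ := exists_isBirthTime htree hk0 hreg hbd
  have hcl := hb.finite_class hg htree.connected hfin hep
  obtain ⟨⟨o, ho⟩, hmin⟩ := hm
  have hmin (y : V) : b o ≤ b y := by
    have := hmin ⟨y, rfl⟩
    rw [← ho, hτ, hτ] at this
    omega
  have hlip {x y : V} (h : T.Adj x y) : b y ≤ b x + 1 := hb.le_add_one_of_adj hg hfin hcl h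
  have huniq {x w w' : V} (hw : T.Adj x w) (hw' : T.Adj x w') (h : b w ≤ b x) (h' : b w' ≤ b x) :
      w = w' := hb.eq_of_adj_of_le hg hfin hcl htree hk hreg hw hw' h h'
  have hcompl {x y : V} (hy : T.Adj x y) (hle : b y ≤ b x) :
      {z | T.Adj x z ∧ b z = b x + 1}.ncard = k - 1 := by
    have : {z | T.Adj x z ∧ b z = b x + 1} = T.neighborSet x \ {y} := by
      ext z
      simp only [Set.mem_ofPred_eq, Set.mem_sdiff, mem_neighborSet, Set.mem_singleton_iff]
      refine and_congr_right fun hz => ⟨?_, fun hne => ?_⟩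
      · rintro h rfl
        omega
      · have := hlip hz
        by_contra hne'
        exact hne (huniq hz hy (by omega) hle)
    rw [this, Set.ncard_sdiff_singleton_of_mem (by exact hy), hreg]
  have hsingle {x y : V} (hy : T.Adj x y) (hle : b y ≤ b x) :
      {z | T.Adj x z ∧ b z = b y}.ncard = 1 := by
    rw [Set.ncard_eq_one]
    refine ⟨y, Set.eq_singleton_iff_unique_mem.2 ⟨⟨hy, rfl⟩, fun z hz => ?_⟩⟩
    exact huniq hz.1 hy (hz.2.trans_le hle) hle
  refine ⟨fun x hx => ?_, fun x hx => ?_⟩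
  · rw [← ho, hτ, hτ] at hx
    obtain ⟨y, hy, hyx⟩ := hb.exists_adj_add_one hg hfin hcl htree.connected
      (x := x) (y := o) (by omega)
    refine ⟨?_, ?_, ?_⟩
    · rw [← hsingle hy (by omega)]
      congr 1
      ext z
      simp only [hτ, Set.mem_ofPred_eq]
      exact and_congr_right fun _ => by omega
    · rw [← hcompl hy (by omega)]
      congr 1
      ext z
      simp only [hτ, Set.mem_ofPred_eq]
      exact and_congr_right fun _ => by omega
    · rintro ⟨z, hz, hzx⟩
      rw [hτ, hτ] at hzx
      have := huniq hz hy (by omega) (by omega)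
      subst this
      omega
  · have hm1 (y : V) : maxType T φ y = m ↔ b y = b x := by
      rw [← hx, hτ, hτ]
      omega
    have hm2 (y : V) : maxType T φ y = m + 1 ↔ b y = b x + 1 := by
      rw [← hx, hτ, hτ]
      omega
    have hxo : b x = b o := by
      rw [← ho, hτ, hτ] at hx
      omega
    have hdich (y : V) (hy : T.Adj x y) : b y = b x ∨ b y = b x + 1 := by
      have := hlip hy
      have := hmin y
      omega
    simp only [hm1, hm2]
    by_cases h : ∃ y, T.Adj x y ∧ b y = b x
    · obtain ⟨y, hy, hyx⟩ := h
      have h1 := hsingle hy hyx.le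
      rw [hyx] at h1
      exact ⟨h1.le, hdich, .inr ⟨h1, hcompl hy hyx.le⟩⟩
    · push Not at h
      have h0 : {y | T.Adj x y ∧ b y = b x} = ∅ :=
        Set.eq_empty_of_forall_notMem fun y hy => h y hy.1 hy.2
      refine ⟨by simp [h0], hdich, .inl fun y hy => (hdich y hy).resolve_left (h y hy)⟩
end
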